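/- arXiv:math/0604323 — 8 statements merged into one kernel-verified Lean document; each statement's English description precedes it below -/
import Mathlib

section
/- With respect to the decomposition E = R ⊕ F, a linear automorphism g of E belongs to Sp_{2n+1}(ω) if and only if its block matrix has the form (λ, ℓ; 0, a) with λ ∈ ℂ*, ℓ a row vector in ℂ^{2n}, and a ∈ Sp_{2n}. Moreover, the subgroup U = {g : λ = 1, a = Id} is a normal subgroup of Sp_{2n+1}(ω) isomorphic to the additive group (ℂ^{2n}, +), and Sp_{2n+1}(ω) is the internal semidirect product of the subgroup {g : ℓ = 0} ≅ ℂ* × Sp_{2n} with U. -/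
open Module Submodule

noncomputable section

variable {E : Type*} [AddCommGroup E] [Module ℂ E]

/-- The group of linear automorphisms preserving a bilinear form
(the (odd) symplectic group of the form). -/
def sympGroup (ω : LinearMap.BilinForm ℂ E) : Subgroup (E ≃ₗ[ℂ] E) where
  carrier := {g | ∀ x y : E, ω (g x) (g y) = ω x y}
  one_mem' := fun _ _ => rfl
  mul_mem' := by
    intro a b ha hb x y
    simp only [Set.mem_setOf_eq] at ha hb ⊢
    rw [show (a * b) x = a (b x) from rfl, show (a * b) y = a (b y) from rfl, ha, hb]
  inv_mem' := by
    intro a ha x y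
    simp only [Set.mem_setOf_eq] at ha ⊢
    have h1 : a ((a⁻¹ : E ≃ₗ[ℂ] E) x) = x := a.apply_symm_apply x
    have h2 : a ((a⁻¹ : E ≃ₗ[ℂ] E) y) = y := a.apply_symm_apply y
    calc ω ((a⁻¹ : E ≃ₗ[ℂ] E) x) ((a⁻¹ : E ≃ₗ[ℂ] E) y)
        = ω (a ((a⁻¹ : E ≃ₗ[ℂ] E) x)) (a ((a⁻¹ : E ≃ₗ[ℂ] E) y)) := (ha _ _).symm
      _ = ω x y := by rw [h1, h2]

/-- Subgroup of automorphisms mapping a given submodule onto itself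
(block upper triangular automorphisms). -/
def stabSubgroup (F : Submodule ℂ E) : Subgroup (E ≃ₗ[ℂ] E) where
  carrier := {g | Submodule.map (g : E →ₗ[ℂ] E) F = F}
  one_mem' := by simp
  mul_mem' := by
    intro a b ha hb
    simp only [Set.mem_setOf_eq] at ha hb ⊢
    have : ((a * b : E ≃ₗ[ℂ] E) : E →ₗ[ℂ] E) = (a : E →ₗ[ℂ] E).comp (b : E →ₗ[ℂ] E) := rfl
    rw [this, Submodule.map_comp, hb, ha]
  inv_mem' := by
    intro a ha
    simp only [Set.mem_setOf_eq] at ha ⊢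
    conv_lhs => rw [← ha]
    rw [← Submodule.map_comp]
    have : ((a⁻¹ : E ≃ₗ[ℂ] E) : E →ₗ[ℂ] E).comp (a : E →ₗ[ℂ] E) = LinearMap.id := by
      ext x
      exact a.symm_apply_apply x
    rw [this, Submodule.map_id]

/-- The subgroup `U` of automorphisms `g` with `g e₀ = e₀` and `g x - x ∈ ℂe₀` for all `x`
(i.e. the block matrices `(1, ℓ; 0, Id)`). -/
def traslU (v : E) : Subgroup (E ≃ₗ[ℂ] E) where
  carrier := {g | g v = v ∧ ∀ x : E, g x - x ∈ Submodule.span ℂ {v}}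
  one_mem' := ⟨rfl, fun x => by simp⟩
  mul_mem' := by
    intro a b ha hb
    refine ⟨?_, fun x => ?_⟩
    · show a (b v) = v
      rw [hb.1, ha.1]
    · show a (b x) - x ∈ _
      have h1 := ha.2 (b x)
      have h2 := hb.2 x
      have h3 : a (b x) - x = (a (b x) - b x) + (b x - x) := by abel
      rw [h3]
      exact add_mem h1 h2
  inv_mem' := by
    intro a ha
    constructor
    · show a.symm v = v
      conv_lhs => rw [← ha.1]
      exact a.symm_apply_apply v
    · intro x
      have h := ha.2 (a.symm x)
      have hx : a (a.symm x) = x := a.apply_symm_apply x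
      rw [hx] at h
      have h4 : (a⁻¹ : E ≃ₗ[ℂ] E) x - x = -(x - a.symm x) := by
        show a.symm x - x = _
        abel
      rw [h4]
      exact neg_mem h

/-- The complement `F = span(e₁, …, e_{2n})` of the kernel line `ℂe₀`. -/
def Fsub (n : ℕ) (e : Basis (Fin (2 * n + 1)) ℂ E) : Submodule ℂ E :=
  Submodule.span ℂ (Set.range fun i : Fin (2 * n) => e i.succ)

section Block

variable (c : E →ₗ[ℂ] ℂ) (v : E)

/-- The projection of `E` onto `ker c` along `v`, where `c v = 1`. -/
def kerProj (hv : c v = 1) : E →ₗ[ℂ] LinearMap.ker c :=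
  LinearMap.codRestrict _ (LinearMap.id - c.smulRight v) fun x => by simp [hv]

variable {c v}

@[simp] theorem coe_kerProj (hv : c v = 1) (x : E) :
    (kerProj c v hv x : E) = x - c x • v := rfl

@[simp] theorem kerProj_self (hv : c v = 1) : kerProj c v hv v = 0 := by
  ext; simp [hv]

@[simp] theorem kerProj_coe (hv : c v = 1) (f : LinearMap.ker c) :
    kerProj c v hv (f : E) = f := by
  ext; simp

theorem smul_add_kerProj (hv : c v = 1) (x : E) : c x • v + (kerProj c v hv x : E) = x := by
  simp

/-- The block diagonal endomorphism `(t, 0; 0, a)` of `E = ℂ v ⊕ ker c`. -/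
def blockMap (hv : c v = 1) (t : ℂ) (a : LinearMap.ker c →ₗ[ℂ] LinearMap.ker c) : E →ₗ[ℂ] E :=
  c.smulRight (t • v) + (LinearMap.ker c).subtype ∘ₗ a ∘ₗ kerProj c v hv

theorem blockMap_apply (hv : c v = 1) (t : ℂ) (a : LinearMap.ker c →ₗ[ℂ] LinearMap.ker c)
    (x : E) : blockMap hv t a x = c x • t • v + (a (kerProj c v hv x) : E) := rfl

theorem blockMap_comp (hv : c v = 1) (s t : ℂ) (a b : LinearMap.ker c →ₗ[ℂ] LinearMap.ker c) :
    blockMap hv s a ∘ₗ blockMap hv t b = blockMap hv (s * t) (a ∘ₗ b) := by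
  ext x
  simp only [LinearMap.comp_apply, blockMap_apply, map_add, map_smul, kerProj_self, kerProj_coe,
    map_zero, ZeroMemClass.coe_zero, hv, LinearMap.map_coe_ker]
  module

theorem blockMap_one_id (hv : c v = 1) : blockMap hv 1 LinearMap.id = LinearMap.id := by
  ext x; simp [blockMap_apply]

/-- The block diagonal automorphism `(t, 0; 0, a)` of `E = ℂ v ⊕ ker c`. -/
def blockEquiv (hv : c v = 1) (t : ℂˣ) (a : LinearMap.ker c ≃ₗ[ℂ] LinearMap.ker c) : E ≃ₗ[ℂ] E :=
  LinearEquiv.ofLinearMap (blockMap hv t a) (blockMap hv (t⁻¹ : ℂˣ) a.symm)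
    (by simp [blockMap_comp, blockMap_one_id]) (by simp [blockMap_comp, blockMap_one_id])

theorem blockEquiv_apply (hv : c v = 1) (t : ℂˣ) (a : LinearMap.ker c ≃ₗ[ℂ] LinearMap.ker c)
    (x : E) : blockEquiv hv t a x = c x • (t : ℂ) • v + (a (kerProj c v hv x) : E) := rfl

theorem blockEquiv_self (hv : c v = 1) (t : ℂˣ) (a : LinearMap.ker c ≃ₗ[ℂ] LinearMap.ker c) :
    blockEquiv hv t a v = (t : ℂ) • v := by
  simp [blockEquiv_apply, -coe_kerProj, hv]

theorem blockEquiv_coe (hv : c v = 1) (t : ℂˣ) (a : LinearMap.ker c ≃ₗ[ℂ] LinearMap.ker c)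
    (f : LinearMap.ker c) : blockEquiv hv t a f = a f := by
  simp [blockEquiv_apply]

theorem blockEquiv_mul (hv : c v = 1) (s t : ℂˣ) (a b : LinearMap.ker c ≃ₗ[ℂ] LinearMap.ker c) :
    blockEquiv hv (s * t) (a * b) = blockEquiv hv s a * blockEquiv hv t b := by
  ext x
  exact (LinearMap.congr_fun (blockMap_comp hv s t a.toLinearMap b.toLinearMap) x).symm

theorem linearEquiv_ext_of_ker (hv : c v = 1) {g h : E ≃ₗ[ℂ] E} (h0 : g v = h v)
    (hk : ∀ f : LinearMap.ker c, g f = h f) : g = h := by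
  ext x
  rw [← smul_add_kerProj hv x, map_add, map_add, map_smul, map_smul, h0, hk]

theorem blockEquiv_mem_stabSubgroup (hv : c v = 1) (t : ℂˣ)
    (a : LinearMap.ker c ≃ₗ[ℂ] LinearMap.ker c) :
    blockEquiv hv t a ∈ stabSubgroup (LinearMap.ker c) := by
  show Submodule.map _ _ = _
  ext x
  constructor
  · rintro ⟨f, hf, rfl⟩
    have := blockEquiv_coe hv t a ⟨f, hf⟩
    simp only [LinearEquiv.coe_coe] at this ⊢
    rw [this]
    exact (a ⟨f, hf⟩).2
  · intro hx
    refine ⟨a.symm ⟨x, hx⟩, (a.symm ⟨x, hx⟩).2, ?_⟩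
    simp [blockEquiv_coe]

variable {ω : LinearMap.BilinForm ℂ E}

theorem mem_sympGroup_of_block (hv : c v = 1) (hl : ∀ x, ω v x = 0) (hr : ∀ x, ω x v = 0)
    {g : E ≃ₗ[ℂ] E} {t : ℂ} {ℓ : LinearMap.ker c → ℂ}
    {a : LinearMap.ker c ≃ₗ[ℂ] LinearMap.ker c}
    (ha : a ∈ sympGroup (ω.restrict (LinearMap.ker c))) (h0 : g v = t • v)
    (hk : ∀ f : LinearMap.ker c, g f = ℓ f • v + (a f : E)) : g ∈ sympGroup ω := by
  intro x y
  have key := ha (kerProj c v hv x) (kerProj c v hv y)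
  simp only [LinearMap.BilinForm.restrict_apply, LinearMap.domRestrict_apply] at key
  rw [← smul_add_kerProj hv x, ← smul_add_kerProj hv y]
  simp only [map_add, map_smul, h0, hk, LinearMap.add_apply, LinearMap.smul_apply, hl, hr,
    smul_zero, zero_add, key]

theorem apply_mem_span_of_mem_sympGroup (hl : ∀ x, ω v x = 0)
    (hnd : ∀ y, (∀ x, ω y x = 0) → y ∈ span ℂ {v}) {g : E ≃ₗ[ℂ] E} (hg : g ∈ sympGroup ω) :
    g v ∈ span ℂ {v} := by
  refine hnd _ fun x => ?_
  rw [← g.apply_symm_apply x, hg, hl]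

theorem exists_block_of_mem_sympGroup (hv : c v = 1) (hl : ∀ x, ω v x = 0)
    (hr : ∀ x, ω x v = 0) (hnd : ∀ y, (∀ x, ω y x = 0) → y ∈ span ℂ {v})
    {g : E ≃ₗ[ℂ] E} (hg : g ∈ sympGroup ω) :
    ∃ (lam : ℂˣ) (ℓ : LinearMap.ker c →ₗ[ℂ] ℂ) (a : LinearMap.ker c ≃ₗ[ℂ] LinearMap.ker c),
      a ∈ sympGroup (ω.restrict (LinearMap.ker c)) ∧ g v = (lam : ℂ) • v ∧
      ∀ f : LinearMap.ker c, g f = ℓ f • v + (a f : E) := by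
  have hv0 : v ≠ 0 := by rintro rfl; simp at hv
  obtain ⟨t, ht⟩ := mem_span_singleton.1 (apply_mem_span_of_mem_sympGroup hl hnd hg)
  obtain ⟨s, hs⟩ := mem_span_singleton.1
    (apply_mem_span_of_mem_sympGroup hl hnd ((sympGroup ω).inv_mem hg))
  change s • v = g.symm v at hs
  have ht0 : t ≠ 0 := by
    rintro rfl
    rw [zero_smul] at ht
    exact hv0 (g.map_eq_zero_iff.1 ht.symm)
  let p := kerProj c v hv
  let a : LinearMap.ker c ≃ₗ[ℂ] LinearMap.ker c := LinearEquiv.ofLinearMap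
    (p ∘ₗ g.toLinearMap ∘ₗ (LinearMap.ker c).subtype)
    (p ∘ₗ g.symm.toLinearMap ∘ₗ (LinearMap.ker c).subtype)
    (by ext f; simp [p, ← ht])
    (by ext f; simp [p, ← hs])
  have hga : ∀ f : LinearMap.ker c, g f = c (g f) • v + (a f : E) := fun f =>
    (smul_add_kerProj hv (g f)).symm
  refine ⟨Units.mk0 t ht0, c ∘ₗ g.toLinearMap ∘ₗ (LinearMap.ker c).subtype, a, ?_, ht.symm, hga⟩
  intro f f'
  have key := hg f f'
  rw [hga f, hga f'] at key
  simpa [hl, hr, -coe_kerProj] using key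

theorem blockEquiv_mem_sympGroup (hv : c v = 1) (hl : ∀ x, ω v x = 0) (hr : ∀ x, ω x v = 0)
    (t : ℂˣ) {a : LinearMap.ker c ≃ₗ[ℂ] LinearMap.ker c}
    (ha : a ∈ sympGroup (ω.restrict (LinearMap.ker c))) : blockEquiv hv t a ∈ sympGroup ω :=
  mem_sympGroup_of_block hv hl hr (ℓ := 0) ha (blockEquiv_self hv t a)
    fun f => by simp [blockEquiv_coe]

/-- Block diagonal automorphisms with symplectic second block, as a group homomorphism. -/
def blockHom (hv : c v = 1) (hl : ∀ x, ω v x = 0) (hr : ∀ x, ω x v = 0) :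
    ℂˣ × sympGroup (ω.restrict (LinearMap.ker c)) →*
      ↥(stabSubgroup (LinearMap.ker c) ⊓ sympGroup ω) :=
  MonoidHom.mk' (fun q => ⟨blockEquiv hv q.1 q.2, blockEquiv_mem_stabSubgroup hv _ _,
    blockEquiv_mem_sympGroup hv hl hr _ q.2.2⟩)
    fun _ _ => Subtype.ext (blockEquiv_mul hv _ _ _ _)

theorem apply_mem_of_mem_stabSubgroup {F : Submodule ℂ E} {g : E ≃ₗ[ℂ] E}
    (hg : g ∈ stabSubgroup F) {f : E} (hf : f ∈ F) : g f ∈ F := by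
  rw [← show Submodule.map (g : E →ₗ[ℂ] E) F = F from hg]
  exact ⟨f, hf, rfl⟩

theorem blockHom_bijective (hv : c v = 1) (hl : ∀ x, ω v x = 0) (hr : ∀ x, ω x v = 0)
    (hnd : ∀ y, (∀ x, ω y x = 0) → y ∈ span ℂ {v}) :
    Function.Bijective (blockHom hv hl hr) := by
  constructor
  · rintro ⟨s, a⟩ ⟨t, b⟩ h
    have h' : blockEquiv hv s (a : LinearMap.ker c ≃ₗ[ℂ] LinearMap.ker c) = blockEquiv hv t b :=
      congrArg Subtype.val h
    refine Prod.ext (Units.ext ?_) (Subtype.ext (LinearEquiv.ext fun f => Subtype.ext ?_))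
    · have := congrArg c (LinearEquiv.congr_fun h' v)
      simpa [blockEquiv_self, hv] using this
    · have := LinearEquiv.congr_fun h' (f : E)
      simpa only [blockEquiv_coe] using this
  · rintro ⟨g, hgs, hg⟩
    obtain ⟨t, ℓ, a, ha, h0, hk⟩ := exists_block_of_mem_sympGroup hv hl hr hnd hg
    refine ⟨(t, ⟨a, ha⟩), Subtype.ext (linearEquiv_ext_of_ker hv ?_ fun f => ?_)⟩
    · exact (blockEquiv_self hv t a).trans h0.symm
    · refine (blockEquiv_coe hv t a f).trans ?_
      have := apply_mem_of_mem_stabSubgroup hgs f.2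
      rw [hk, LinearMap.mem_ker, map_add, map_smul, hv, LinearMap.map_coe_ker] at this
      rw [hk, show ℓ f = 0 by simpa using this, zero_smul, zero_add]

theorem traslU_le_sympGroup (hl : ∀ x, ω v x = 0) (hr : ∀ x, ω x v = 0) :
    traslU v ≤ sympGroup ω := by
  intro u hu x y
  obtain ⟨s, hs⟩ := mem_span_singleton.1 (hu.2 x)
  obtain ⟨t, ht⟩ := mem_span_singleton.1 (hu.2 y)
  rw [← sub_add_cancel (u x) x, ← sub_add_cancel (u y) y, ← hs, ← ht]
  simp [hl, hr]

theorem conj_mem_traslU {g u : E ≃ₗ[ℂ] E} (hg : g v ∈ span ℂ {v})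
    (hg' : g⁻¹ v ∈ span ℂ {v}) (hu : u ∈ traslU v) : g * u * g⁻¹ ∈ traslU v := by
  obtain ⟨t, ht⟩ := mem_span_singleton.1 hg
  obtain ⟨s, hs⟩ := mem_span_singleton.1 hg'
  have hcancel : ∀ x, g (g⁻¹ x) = x := g.apply_symm_apply
  refine ⟨?_, fun x => ?_⟩
  · rw [LinearEquiv.mul_apply, LinearEquiv.mul_apply, ← hs, map_smul, hu.1, hs, hcancel]
  · obtain ⟨r, hr⟩ := mem_span_singleton.1 (hu.2 (g⁻¹ x))
    rw [LinearEquiv.mul_apply, LinearEquiv.mul_apply, ← sub_add_cancel (u (g⁻¹ x)) (g⁻¹ x), ← hr,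
      map_add, hcancel, add_sub_cancel_right, map_smul]
    exact smul_mem _ _ hg

theorem stabSubgroup_inf_traslU (hv : c v = 1) :
    stabSubgroup (LinearMap.ker c) ⊓ traslU v = ⊥ := by
  rw [eq_bot_iff]
  rintro g ⟨hgs, hu⟩
  refine linearEquiv_ext_of_ker hv hu.1 fun f => ?_
  obtain ⟨s, hs⟩ := mem_span_singleton.1 (hu.2 f)
  have hf : c (g f - f) = 0 :=
    sub_mem (apply_mem_of_mem_stabSubgroup hgs f.2) f.2
  have hs0 : s = 0 := by simpa [← hs, hv] using hf
  rw [hs0, zero_smul] at hs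
  exact (sub_eq_zero.1 hs.symm)

theorem exists_mul_of_mem_sympGroup (hv : c v = 1) (hl : ∀ x, ω v x = 0)
    (hr : ∀ x, ω x v = 0) (hnd : ∀ y, (∀ x, ω y x = 0) → y ∈ span ℂ {v})
    {g : E ≃ₗ[ℂ] E} (hg : g ∈ sympGroup ω) :
    ∃ h ∈ stabSubgroup (LinearMap.ker c) ⊓ sympGroup ω, ∃ u ∈ traslU v, g = h * u := by
  obtain ⟨t, ℓ, a, ha, h0, hk⟩ := exists_block_of_mem_sympGroup hv hl hr hnd hg
  set h := blockEquiv hv t a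
  have hh : h ∈ sympGroup ω := blockEquiv_mem_sympGroup hv hl hr t ha
  have hcancel : ∀ x, h⁻¹ (h x) = x := h.symm_apply_apply
  refine ⟨h, ⟨blockEquiv_mem_stabSubgroup hv t a, hh⟩, h⁻¹ * g, ⟨?_, fun x => ?_⟩,
    (mul_inv_cancel_left h g).symm⟩
  · rw [LinearEquiv.mul_apply, h0, ← blockEquiv_self hv t a, hcancel]
  · have hx : g x = ℓ (kerProj c v hv x) • v + h x := by
      conv_lhs => rw [← smul_add_kerProj hv x]
      rw [map_add, map_smul, h0, hk, blockEquiv_apply]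
      abel
    rw [LinearEquiv.mul_apply, hx, map_add, hcancel, add_sub_cancel_right, map_smul]
    exact smul_mem _ _ (apply_mem_span_of_mem_sympGroup hl hnd (inv_mem hh))

end Block

section Basis

variable {n : ℕ} (e : Basis (Fin (2 * n + 1)) ℂ E)

theorem Fsub_eq_ker_coord : Fsub n e = LinearMap.ker (e.coord 0) := by
  refine le_antisymm (span_le.2 ?_) fun x hx => ?_
  · rintro _ ⟨i, rfl⟩
    simp
  · rw [← e.sum_repr x, Fin.sum_univ_succ,
      show e.repr x 0 = 0 from hx, zero_smul, zero_add]
    exact sum_mem fun i _ => smul_mem _ _ (subset_span ⟨i, rfl⟩)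

/-- A transvection `x ↦ x + ℓ(x) e₀` is recorded by the values of `ℓ` on `e₁, …, e_{2n}`. -/
def traslUHom : traslU (e 0) →* Multiplicative (Fin (2 * n) → ℂ) :=
  MonoidHom.mk' (fun u => Multiplicative.ofAdd fun i => e.coord 0 (u.1 (e i.succ))) (by
    rintro ⟨a, ha⟩ ⟨b, hb⟩
    rw [← ofAdd_add]
    congr 1
    funext i
    obtain ⟨s, hs⟩ := mem_span_singleton.1 (hb.2 (e i.succ))
    have hbi : b (e i.succ) = s • e 0 + e i.succ := by rw [hs, sub_add_cancel]
    show e.coord 0 (a (b (e i.succ))) = e.coord 0 (a (e i.succ)) + e.coord 0 (b (e i.succ))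
    rw [hbi, map_add, map_smul, ha.1, map_add, map_add]
    have : e.coord 0 (e i.succ) = 0 := by simp
    rw [this]
    ring)

theorem traslUHom_bijective : Function.Bijective (traslUHom e) := by
  constructor
  · rintro ⟨a, ha⟩ ⟨b, hb⟩ h
    refine Subtype.ext (LinearEquiv.toLinearMap_injective (e.ext fun j => ?_))
    refine Fin.cases (ha.1.trans hb.1.symm) (fun i => ?_) j
    have hi : e.coord 0 (a (e i.succ)) = e.coord 0 (b (e i.succ)) :=
      congrFun (congrArg Multiplicative.toAdd h) i
    obtain ⟨s, hs⟩ := mem_span_singleton.1 (ha.2 (e i.succ))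
    obtain ⟨t, ht⟩ := mem_span_singleton.1 (hb.2 (e i.succ))
    have hai : a (e i.succ) = s • e 0 + e i.succ := by rw [hs, sub_add_cancel]
    have hbi : b (e i.succ) = t • e 0 + e i.succ := by rw [ht, sub_add_cancel]
    rw [hai, hbi] at hi
    show a (e i.succ) = b (e i.succ)
    rw [hai, hbi, show s = t by simpa using hi]
  · intro w
    let L : Dual ℂ E := e.constr ℂ (Fin.cons 0 w.toAdd : Fin (2 * n + 1) → ℂ)
    have hL0 : L (e 0) = 0 := by simp [L]
    refine ⟨⟨LinearEquiv.transvection hL0, ?_, fun x => ?_⟩, ?_⟩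
    · simp [LinearMap.transvection.apply, hL0]
    · simpa [LinearMap.transvection.apply] using smul_mem _ _ (mem_span_singleton_self _)
    · refine Multiplicative.toAdd.injective (funext fun i => ?_)
      show e.coord 0 (LinearEquiv.transvection hL0 (e i.succ)) = w.toAdd i
      have : e.coord 0 (e i.succ) = 0 := by simp
      rw [LinearEquiv.transvection.apply, map_add, this]
      simp [L]

variable {ω : LinearMap.BilinForm ℂ E} {e}

theorem apply_basis_eq_zero (halt : ω.IsAlt)
    (he : ∀ i j : Fin (2 * n + 1), (i : ℕ) < (j : ℕ) →
      ω (e i) (e j) = if (i : ℕ) + (j : ℕ) = 2 * n + 1 then 1 else 0)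
    {i j : Fin (2 * n + 1)} (hij : (i : ℕ) + j ≠ 2 * n + 1) : ω (e i) (e j) = 0 := by
  rcases lt_trichotomy (i : ℕ) j with h | h | h
  · rw [he i j h, if_neg hij]
  · rw [Fin.ext h, halt]
  · rw [← halt.neg_eq, he j i h, if_neg (by omega), neg_zero]

theorem apply_basis_ne_zero (halt : ω.IsAlt)
    (he : ∀ i j : Fin (2 * n + 1), (i : ℕ) < (j : ℕ) →
      ω (e i) (e j) = if (i : ℕ) + (j : ℕ) = 2 * n + 1 then 1 else 0)
    {i j : Fin (2 * n + 1)} (hij : (i : ℕ) + j = 2 * n + 1) : ω (e i) (e j) ≠ 0 := by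
  rcases lt_trichotomy (i : ℕ) j with h | h | h
  · simp [he i j h, hij]
  · omega
  · rw [← halt.neg_eq, he j i h, if_pos (by omega)]
    simp

theorem apply_basis_zero_left (halt : ω.IsAlt)
    (he : ∀ i j : Fin (2 * n + 1), (i : ℕ) < (j : ℕ) →
      ω (e i) (e j) = if (i : ℕ) + (j : ℕ) = 2 * n + 1 then 1 else 0) (x : E) :
    ω (e 0) x = 0 := by
  have : ω (e 0) = 0 := e.ext fun j =>
    apply_basis_eq_zero halt he (by rw [Fin.val_zero]; omega)
  rw [this, LinearMap.zero_apply]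

theorem mem_span_of_forall_apply_eq_zero (halt : ω.IsAlt)
    (he : ∀ i j : Fin (2 * n + 1), (i : ℕ) < (j : ℕ) →
      ω (e i) (e j) = if (i : ℕ) + (j : ℕ) = 2 * n + 1 then 1 else 0) {y : E}
    (hy : ∀ x, ω y x = 0) : y ∈ span ℂ {e 0} := by
  have hcoord : ∀ i : Fin (2 * n), e.repr y i.succ = 0 := by
    intro i
    let k : Fin (2 * n + 1) := ⟨2 * n - i, by omega⟩
    have hk : ((i.succ : Fin (2 * n + 1)) : ℕ) + k = 2 * n + 1 := by
      simp only [Fin.val_succ, k]; omega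
    have h := hy (e k)
    rw [← e.sum_repr y, map_sum, LinearMap.sum_apply, Finset.sum_eq_single i.succ] at h
    · simpa [apply_basis_ne_zero halt he hk] using h
    · intro j _ hj
      have : (j : ℕ) + k ≠ 2 * n + 1 := fun h' => hj (Fin.ext (by omega))
      simp [apply_basis_eq_zero halt he this]
    · simp
  rw [← e.sum_repr y, Fin.sum_univ_succ]
  simpa [hcoord] using smul_mem _ _ (mem_span_singleton_self _)

end Basis

/-- With respect to the decomposition `E = ℂe₀ ⊕ F` given by an odd
symplectic basis, an automorphism `g` of `E` lies in the odd symplectic group iff it has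
block form `(λ, ℓ; 0, a)` with `λ ∈ ℂˣ`, `ℓ ∈ F*` and `a ∈ Sp(F)`.  Moreover the subgroup
`U` (those with `λ = 1`, `a = Id`) is a normal subgroup of `Sp_{2n+1}(ω)` isomorphic to
the additive group `ℂ^{2n}`, and `Sp_{2n+1}(ω)` is the internal semidirect product of the
subgroup `{g : ℓ = 0} ≅ ℂˣ × Sp_{2n}` with `U`. -/
theorem odd_symplectic_group_structure
    (n : ℕ) (hn : 1 ≤ n) [FiniteDimensional ℂ E] (hdim : finrank ℂ E = 2 * n + 1)
    (ω : LinearMap.BilinForm ℂ E) (halt : ω.IsAlt)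
    (e : Basis (Fin (2 * n + 1)) ℂ E)
    (he : ∀ i j : Fin (2 * n + 1), (i : ℕ) < (j : ℕ) →
      ω (e i) (e j) = if (i : ℕ) + (j : ℕ) = 2 * n + 1 then 1 else 0) :
    -- block matrix description of the odd symplectic group
    (∀ g : E ≃ₗ[ℂ] E, g ∈ sympGroup ω ↔
      ∃ (lam : ℂˣ) (ℓ : ↥(Fsub n e) →ₗ[ℂ] ℂ)
        (a : ↥(Fsub n e) ≃ₗ[ℂ] ↥(Fsub n e)),
          a ∈ sympGroup (ω.restrict (Fsub n e)) ∧
          g (e 0) = (lam : ℂ) • e 0 ∧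
          (∀ f : ↥(Fsub n e), g (f : E) = ℓ f • e 0 + ((a f : ↥(Fsub n e)) : E))) ∧
    -- U is a subgroup of the odd symplectic group …
    traslU (e 0) ≤ sympGroup ω ∧
    -- … which is normal in it …
    (∀ g ∈ sympGroup ω, ∀ u ∈ traslU (e 0), g * u * g⁻¹ ∈ traslU (e 0)) ∧
    -- … and isomorphic to the additive group ℂ^{2n}
    Nonempty (↥(traslU (e 0)) ≃* Multiplicative (Fin (2 * n) → ℂ)) ∧
    -- the subgroup with ℓ = 0 is isomorphic to ℂˣ × Sp_{2n}
    Nonempty (↥(stabSubgroup (Fsub n e) ⊓ sympGroup ω) ≃*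
      ℂˣ × ↥(sympGroup (ω.restrict (Fsub n e)))) ∧
    -- internal semidirect product: trivial intersection and the product is everything
    (stabSubgroup (Fsub n e) ⊓ sympGroup ω) ⊓ traslU (e 0) = ⊥ ∧
    (∀ g ∈ sympGroup ω, ∃ h ∈ stabSubgroup (Fsub n e) ⊓ sympGroup ω,
      ∃ u ∈ traslU (e 0), g = h * u) := by
  have hv : e.coord 0 (e 0) = 1 := by simp
  have hl := apply_basis_zero_left halt he
  have hr : ∀ x, ω x (e 0) = 0 := fun x => by rw [← halt.neg_eq, hl, neg_zero]
  have hnd : ∀ y, (∀ x, ω y x = 0) → y ∈ span ℂ {e 0} := fun _ =>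
    mem_span_of_forall_apply_eq_zero halt he
  rw [Fsub_eq_ker_coord]
  refine ⟨fun g => ⟨exists_block_of_mem_sympGroup hv hl hr hnd, ?_⟩, traslU_le_sympGroup hl hr,
    fun g hg u hu => conj_mem_traslU (apply_mem_span_of_mem_sympGroup hl hnd hg)
      (apply_mem_span_of_mem_sympGroup hl hnd (inv_mem hg)) hu,
    ⟨MulEquiv.ofBijective _ (traslUHom_bijective e)⟩,
    ⟨(MulEquiv.ofBijective _ (blockHom_bijective hv hl hr hnd)).symm⟩, ?_,
    fun g hg => exists_mul_of_mem_sympGroup hv hl hr hnd hg⟩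
  · rintro ⟨t, ℓ, a, ha, h0, hk⟩
    exact mem_sympGroup_of_block hv hl hr ha h0 hk
  · rw [inf_right_comm, stabSubgroup_inf_traslU hv, bot_inf_eq]

end
end

section
/- The center of the odd symplectic group Sp_{2n+1}(ω) equals {Id, −Id}. -/
open Module Submodule

noncomputable section

variable {E : Type*} [AddCommGroup E] [Module ℂ E]

/-- The automorphism `x ↦ x + f x • k`, which exists as soon as `1 + f k ≠ 0`. -/
def rankOneUpdate (f : Dual ℂ E) (k : E) (hf : 1 + f k ≠ 0) : E ≃ₗ[ℂ] E where
  toFun x := x + f x • k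
  map_add' x y := by simp only [map_add]; module
  map_smul' c x := by simp only [map_smul, RingHom.id_apply, smul_eq_mul]; module
  invFun x := x - ((1 + f k)⁻¹ * f x) • k
  left_inv x := by
    simp only [map_add, map_smul, smul_eq_mul]
    match_scalars <;> field_simp
    ring
  right_inv x := by
    simp only [map_sub, map_smul, smul_eq_mul]
    match_scalars <;> field_simp
    ring

theorem rankOneUpdate_apply (f : Dual ℂ E) (k : E) (hf : 1 + f k ≠ 0) (x : E) :
    rankOneUpdate f k hf x = x + f x • k := rfl

theorem rankOneUpdate_mem_sympGroup {ω : LinearMap.BilinForm ℂ E} (halt : ω.IsAlt)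
    (f : Dual ℂ E) {k : E} (hk : k ∈ LinearMap.ker ω) (hf : 1 + f k ≠ 0) :
    rankOneUpdate f k hf ∈ sympGroup ω := by
  intro x y
  have hk_left (z : E) : ω k z = 0 := by rw [LinearMap.mem_ker.mp hk, LinearMap.zero_apply]
  have hk_right (z : E) : ω z k = 0 := by rw [← halt.neg_eq, hk_left, neg_zero]
  simp [rankOneUpdate_apply, hk_left, hk_right]

/-- An automorphism commuting with all elements of the group of an alternating form with
nontrivial kernel is a scalar. -/
theorem exists_eq_smul_of_commute_sympGroup {ω : LinearMap.BilinForm ℂ E} (halt : ω.IsAlt)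
    {k : E} (hk : k ∈ LinearMap.ker ω) (hk0 : k ≠ 0) {g : E ≃ₗ[ℂ] E}
    (hg : ∀ h ∈ sympGroup ω, g * h = h * g) : ∃ c : ℂ, ∀ x : E, g x = c • x := by
  have hcomm (f : Dual ℂ E) (hf : 1 + f k ≠ 0) (x : E) : f x • g k = f (g x) • k := by
    have h := LinearEquiv.congr_fun (hg _ (rankOneUpdate_mem_sympGroup halt f hk hf)) x
    simpa [LinearEquiv.mul_apply, rankOneUpdate_apply] using h
  obtain ⟨f₀, hf₀⟩ : ∃ f : Dual ℂ E, f k = 1 := by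
    obtain ⟨f, hf⟩ := not_forall.mp (mt (forall_dual_apply_eq_zero_iff ℂ k).mp hk0)
    exact ⟨(f k)⁻¹ • f, by simp [hf]⟩
  have hgk : g k = f₀ (g k) • k := by
    simpa [hf₀] using hcomm f₀ (by rw [hf₀]; norm_num) k
  refine ⟨f₀ (g k), fun x => sub_eq_zero.mp ((forall_dual_apply_eq_zero_iff ℂ _).mp ?_)⟩
  have key (f : Dual ℂ E) (hf : 1 + f k ≠ 0) : f (g x - f₀ (g k) • x) = 0 := by
    have h := hcomm f hf x
    rw [hgk, smul_smul] at h
    rw [map_sub, map_smul, smul_eq_mul, ← smul_left_injective ℂ hk0 h, mul_comm, sub_self]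
  intro f
  by_cases hf : 1 + f k = 0
  · have hf' : 1 + (-f) k ≠ 0 := by
      rw [LinearMap.neg_apply, eq_neg_of_add_eq_zero_right hf]
      norm_num
    simpa only [LinearMap.neg_apply, neg_eq_zero] using key (-f) hf'
  · exact key f hf

/-- The center of the odd symplectic group `Sp_{2n+1}(ω)` of a
skew-symmetric form of maximal rank `2n` on a `(2n+1)`-dimensional complex vector space
equals `{Id, −Id}`: an element of the group commutes with every element of the group
iff it is `Id` or `−Id`. -/
theorem odd_symplectic_center
    (n : ℕ) (hn : 1 ≤ n) [FiniteDimensional ℂ E] (hdim : finrank ℂ E = 2 * n + 1)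
    (ω : LinearMap.BilinForm ℂ E) (halt : ω.IsAlt)
    (hker : finrank ℂ (LinearMap.ker ω) = 1) :
    ∀ g ∈ sympGroup ω,
      ((∀ h ∈ sympGroup ω, g * h = h * g) ↔ (g = 1 ∨ ∀ x : E, g x = -x)) := by
  intro g hg
  constructor
  · intro hcomm
    obtain ⟨k, hk, hk0⟩ : ∃ k ∈ LinearMap.ker ω, k ≠ 0 :=
      (Submodule.ne_bot_iff _).mp fun h => by
        rw [h, finrank_bot] at hker
        omega
    obtain ⟨c, hc⟩ := exists_eq_smul_of_commute_sympGroup halt hk hk0 hcomm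
    have hω : ω ≠ 0 := by
      rintro rfl
      rw [LinearMap.ker_zero, finrank_top] at hker
      omega
    obtain ⟨x, y, hxy⟩ : ∃ x y, ω x y ≠ 0 := by
      by_contra! h
      exact hω (LinearMap.ext₂ h)
    have hcc : c * c = 1 := by
      have h := hg x y
      rw [hc, hc, map_smul, map_smul, LinearMap.smul_apply, smul_smul, smul_eq_mul] at h
      exact mul_eq_right₀ hxy |>.mp h
    refine (mul_self_eq_one_iff.mp hcc).imp (fun h => ?_) (fun h z => ?_)
    · ext z
      rw [hc, h, one_smul, LinearEquiv.coe_one, id]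
    · rw [hc, h, neg_one_smul]
  · rintro (rfl | hneg) h -
    · rw [one_mul, mul_one]
    · ext x
      simp [LinearEquiv.mul_apply, hneg]

end
end

section
/- The parabolic subgroup P = {g ∈ Sp_{2n+2}(ω̃) : g(ℂe_0) = ℂe_0} preserves the hyperplane E = (ℂe_0)^⊥ = span(e_0, …, e_{2n}), and the restriction map g ↦ g|_E is a surjective group homomorphism from P onto the odd symplectic group Sp_{2n+1}(ω), where ω = ω̃|_{E×E}. -/
open Module Submodule

noncomputable section

variable {E : Type*} [AddCommGroup E] [Module ℂ E]

/-- Restriction of a form-preserving automorphism group to a common invariant submodule. -/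
def sympGroupRestrict (B : LinearMap.BilinForm ℂ E) (S : Subgroup (E ≃ₗ[ℂ] E))
    (hS : S ≤ sympGroup B) (H : Submodule ℂ E)
    (hH : ∀ g ∈ S, H.map (g : E →ₗ[ℂ] E) = H) :
    S →* sympGroup (B.restrict H) :=
  MonoidHom.mk'
    (fun g => ⟨(g : E ≃ₗ[ℂ] E).ofSubmodules H H (hH g g.2), fun x y => hS g.2 x y⟩)
    (fun _ _ => Subtype.ext <| LinearEquiv.ext fun _ => rfl)

/-- If `H = e^⊥` and `B e f = 1`, a vector orthogonal to `H` is a multiple of `e`. -/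
theorem mem_span_singleton_of_forall_apply_eq_zero {B : LinearMap.BilinForm ℂ E}
    (hB : ∀ x, (∀ y, B x y = 0) → x = 0) {H : Submodule ℂ E} {e f : E}
    (hH : ∀ x, x ∈ H ↔ B e x = 0) (hef : B e f = 1) {x : E} (hx : ∀ y ∈ H, B x y = 0) :
    x ∈ span ℂ {e} := by
  rw [mem_span_singleton]
  refine ⟨B x f, (sub_eq_zero.mp (hB _ fun y => ?_)).symm⟩
  have h := hx (y - B e y • f) ((hH _).mpr (by simp [hef]))
  simp only [map_sub, map_smul, smul_eq_mul, LinearMap.sub_apply, LinearMap.smul_apply] at h ⊢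
  linear_combination h

theorem map_orthogonal_eq_of_mem_stabSubgroup [FiniteDimensional ℂ E]
    {B : LinearMap.BilinForm ℂ E} {H : Submodule ℂ E} {e : E} (he : e ≠ 0)
    (hH : ∀ x, x ∈ H ↔ B e x = 0) {g : E ≃ₗ[ℂ] E}
    (hg : g ∈ sympGroup B ⊓ stabSubgroup (span ℂ {e})) :
    H.map (g : E →ₗ[ℂ] E) = H := by
  obtain ⟨hgB, hge⟩ := hg
  refine eq_of_le_of_finrank_eq ?_ (LinearEquiv.finrank_map_eq g H)
  rintro _ ⟨x, hx, rfl⟩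
  have hmem : g e ∈ span ℂ {e} :=
    (show map (g : E →ₗ[ℂ] E) (span ℂ {e}) = span ℂ {e} from hge) ▸
      mem_map_of_mem (f := (g : E →ₗ[ℂ] E)) (mem_span_singleton_self e)
  obtain ⟨c, hc⟩ := mem_span_singleton.mp hmem
  have hc0 : c ≠ 0 := by
    rintro rfl
    exact he (g.map_eq_zero_iff.mp (by rw [← hc, zero_smul]))
  have h : B (g e) (g x) = 0 := (hgB e x).trans ((hH x).mp hx)
  rw [← hc, map_smul, LinearMap.smul_apply, smul_eq_mul] at h
  exact (hH _).mpr ((mul_eq_zero.mp h).resolve_left hc0)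

/-- An isometry of `H = e^⊥` extends to an isometry of the ambient symplectic space. -/
theorem exists_extension_of_mem_sympGroup_restrict [FiniteDimensional ℂ E]
    {B : LinearMap.BilinForm ℂ E} (halt : B.IsAlt)
    (hB : ∀ x, (∀ y, B x y = 0) → x = 0) {H : Submodule ℂ E} {e f : E}
    (hH : ∀ x, x ∈ H ↔ B e x = 0) (hef : B e f = 1) {g : H ≃ₗ[ℂ] H}
    (hg : g ∈ sympGroup (B.restrict H)) :
    ∃ G : E ≃ₗ[ℂ] E, G ∈ sympGroup B ∧ ∀ x : H, G x = g x := by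
  have hinj : Function.Injective B := by
    rw [injective_iff_map_eq_zero]
    exact fun x hx => hB x fun y => by rw [hx, LinearMap.zero_apply]
  have hsurj : Function.Surjective B :=
    (LinearMap.injective_iff_surjective_of_finrank_eq_finrank
      (Subspace.dual_finrank_eq (K := ℂ) (V := E)).symm).mp hinj
  obtain ⟨l, hl⟩ := LinearMap.exists_extend ((B f).comp (H.subtype.comp g.symm.toLinearMap))
  obtain ⟨f', hf'⟩ := hsurj l
  have hf'g (x : H) : B f' (g x) = B f x := by
    have := LinearMap.congr_fun hl (g x)
    simpa [hf'] using this
  let p : E →ₗ[ℂ] H :=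
    LinearMap.codRestrict H (LinearMap.id - (B e).smulRight f) fun x =>
      (hH _).mpr (by simp [hef])
  have hp (x : E) : x = p x + B e x • f := by simp [p]
  have hpH (x : H) : p x = x := Subtype.ext <| by simp [p, (hH x).mp x.2]
  let G : E →ₗ[ℂ] E := H.subtype.comp (g.toLinearMap.comp p) + (B e).smulRight f'
  have hG (x : E) : G x = g (p x) + B e x • f' := by simp [G]
  have hGB (x y : E) : B (G x) (G y) = B x y := by
    have h1 : B (g (p x)) (g (p y)) = B (p x : E) (p y) := hg (p x) (p y)
    have h2 : B (g (p x) : E) f' = B (p x : E) f := by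
      rw [← halt.neg_eq, hf'g, halt.neg_eq]
    conv_rhs => rw [hp x, hp y]
    rw [hG, hG]
    simp only [map_add, map_smul, LinearMap.add_apply, LinearMap.smul_apply, smul_eq_mul,
      h1, h2, hf'g, halt.self_eq_zero]
  have hGinj : Function.Injective G := by
    rw [injective_iff_map_eq_zero]
    exact fun x hx => hB x fun y => by rw [← hGB, hx, map_zero, LinearMap.zero_apply]
  refine ⟨LinearEquiv.ofInjectiveEndo G hGinj, hGB, fun x => ?_⟩
  change G x = g x
  rw [hG, hpH, (hH x).mp x.2, zero_smul, add_zero]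

theorem mem_stabSubgroup_span_singleton_of_extends [FiniteDimensional ℂ E]
    {B : LinearMap.BilinForm ℂ E}
    (hB : ∀ x, (∀ y, B x y = 0) → x = 0) {H : Submodule ℂ E} {e f : E}
    (hH : ∀ x, x ∈ H ↔ B e x = 0) (hef : B e f = 1) {g : H ≃ₗ[ℂ] H} {G : E ≃ₗ[ℂ] E}
    (hG : G ∈ sympGroup B) (hGg : ∀ x : H, G x = g x) :
    G ∈ stabSubgroup (span ℂ {e}) := by
  refine eq_of_le_of_finrank_eq ?_ (LinearEquiv.finrank_map_eq G _)
  rw [map_span_le]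
  rintro _ rfl
  refine mem_span_singleton_of_forall_apply_eq_zero hB hH hef fun y hy => ?_
  have hy' : G (g.symm ⟨y, hy⟩) = y := by rw [hGg, g.apply_symm_apply]
  rw [← hy']
  exact (hG _ _).trans ((hH _).mp (g.symm ⟨y, hy⟩).2)

theorem symplecticBasis_apply_eq_zero
    {n : ℕ} {B : LinearMap.BilinForm ℂ E} (halt : B.IsAlt)
    (b : Basis (Fin (2 * n + 2)) ℂ E)
    (hb : ∀ i j : Fin (2 * n + 2), (i : ℕ) < (j : ℕ) →
      B (b i) (b j) = if (i : ℕ) + (j : ℕ) = 2 * n + 1 then 1 else 0)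
    {i j : Fin (2 * n + 2)} (hij : (i : ℕ) + j ≠ 2 * n + 1) : B (b i) (b j) = 0 := by
  rcases lt_trichotomy (i : ℕ) j with h | h | h
  · rw [hb i j h, if_neg hij]
  · rw [Fin.ext h, halt.self_eq_zero]
  · rw [← halt.neg_eq, hb j i h, if_neg (by omega), neg_zero]

theorem symplecticBasis_apply_rev_ne_zero
    {n : ℕ} {B : LinearMap.BilinForm ℂ E} (halt : B.IsAlt)
    (b : Basis (Fin (2 * n + 2)) ℂ E)
    (hb : ∀ i j : Fin (2 * n + 2), (i : ℕ) < (j : ℕ) →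
      B (b i) (b j) = if (i : ℕ) + (j : ℕ) = 2 * n + 1 then 1 else 0)
    (i : Fin (2 * n + 2)) :
    B (b i) (b i.rev) ≠ 0 := by
  have hi := Fin.val_rev i
  rcases lt_trichotomy (i : ℕ) i.rev with h | h | h
  · rw [hb i i.rev h, if_pos (by omega)]
    exact one_ne_zero
  · omega
  · rw [← halt.neg_eq, hb i.rev i h, if_pos (by omega)]
    exact neg_ne_zero.mpr one_ne_zero

theorem apply_symplecticBasis_rev
    {n : ℕ} {B : LinearMap.BilinForm ℂ E} (halt : B.IsAlt)
    (b : Basis (Fin (2 * n + 2)) ℂ E)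
    (hb : ∀ i j : Fin (2 * n + 2), (i : ℕ) < (j : ℕ) →
      B (b i) (b j) = if (i : ℕ) + (j : ℕ) = 2 * n + 1 then 1 else 0)
    (x : E) (i : Fin (2 * n + 2)) :
    B x (b i.rev) = b.repr x i * B (b i) (b i.rev) := by
  conv_lhs => rw [← b.sum_repr x]
  simp only [map_sum, map_smul, LinearMap.sum_apply, LinearMap.smul_apply, smul_eq_mul]
  refine Finset.sum_eq_single i (fun j _ hj => ?_) (by simp)
  have hi := Fin.val_rev i
  have hj' := Fin.val_ne_of_ne hj
  rw [symplecticBasis_apply_eq_zero halt b hb (by omega), mul_zero]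

theorem eq_zero_of_forall_apply_eq_zero_of_symplecticBasis
    {n : ℕ} {B : LinearMap.BilinForm ℂ E} (halt : B.IsAlt)
    (b : Basis (Fin (2 * n + 2)) ℂ E)
    (hb : ∀ i j : Fin (2 * n + 2), (i : ℕ) < (j : ℕ) →
      B (b i) (b j) = if (i : ℕ) + (j : ℕ) = 2 * n + 1 then 1 else 0)
    (x : E) (hx : ∀ y, B x y = 0) :
    x = 0 := by
  refine b.ext_elem fun i => ?_
  have h := apply_symplecticBasis_rev halt b hb x i
  rw [hx, eq_comm, mul_eq_zero] at h
  simpa using h.resolve_right (symplecticBasis_apply_rev_ne_zero halt b hb i)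

theorem mem_span_symplecticBasis_castSucc_iff
    {n : ℕ} {B : LinearMap.BilinForm ℂ E} (halt : B.IsAlt)
    (b : Basis (Fin (2 * n + 2)) ℂ E)
    (hb : ∀ i j : Fin (2 * n + 2), (i : ℕ) < (j : ℕ) →
      B (b i) (b j) = if (i : ℕ) + (j : ℕ) = 2 * n + 1 then 1 else 0)
    (x : E) :
    x ∈ span ℂ (Set.range fun i : Fin (2 * n + 1) => b i.castSucc) ↔ B (b 0) x = 0 := by
  constructor
  · intro hx
    have hle : span ℂ (Set.range fun i : Fin (2 * n + 1) => b i.castSucc) ≤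
        LinearMap.ker (B (b 0)) := by
      rw [span_le]
      rintro _ ⟨i, rfl⟩
      refine symplecticBasis_apply_eq_zero halt b hb ?_
      simp only [Fin.val_zero, Fin.val_castSucc]
      omega
    exact hle hx
  · intro hx
    have h := apply_symplecticBasis_rev halt b hb x (Fin.last _)
    rw [Fin.rev_last, ← halt.neg_eq, hx, neg_zero, eq_comm, mul_eq_zero] at h
    have h0 := h.resolve_right
      (by simpa using symplecticBasis_apply_rev_ne_zero halt b hb (Fin.last _))
    rw [← b.sum_repr x, Fin.sum_univ_castSucc, h0, zero_smul, add_zero]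
    exact sum_mem fun i _ => smul_mem _ _ (subset_span ⟨i, rfl⟩)

/-- Let `Ẽ` be a `(2n+2)`-dimensional complex symplectic vector space
with symplectic basis `e₀, …, e_{2n+1}`.  The parabolic subgroup
`P = {g ∈ Sp_{2n+2}(ω̃) : g(ℂe₀) = ℂe₀}` preserves the hyperplane
`E = span(e₀, …, e_{2n})`, and restriction to this hyperplane is a surjective group
homomorphism from `P` onto the odd symplectic group `Sp_{2n+1}(ω)` of `ω = ω̃|_{E×E}`. -/
theorem parabolic_restriction_surjective
    (n : ℕ) (hn : 1 ≤ n)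
    {Et : Type*} [AddCommGroup Et] [Module ℂ Et] [FiniteDimensional ℂ Et]
    (hdim : finrank ℂ Et = 2 * n + 2)
    (ωt : LinearMap.BilinForm ℂ Et) (halt : ωt.IsAlt)
    (et : Basis (Fin (2 * n + 2)) ℂ Et)
    (het : ∀ i j : Fin (2 * n + 2), (i : ℕ) < (j : ℕ) →
      ωt (et i) (et j) = if (i : ℕ) + (j : ℕ) = 2 * n + 1 then 1 else 0) :
    -- every element of P preserves the hyperplane E = span(e₀, …, e_{2n}) …
    (∀ g : Et ≃ₗ[ℂ] Et,
      g ∈ sympGroup ωt ⊓ stabSubgroup (Submodule.span ℂ {et 0}) →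
      Submodule.map (g : Et →ₗ[ℂ] Et)
        (Submodule.span ℂ (Set.range fun i : Fin (2 * n + 1) => et i.castSucc)) =
        Submodule.span ℂ (Set.range fun i : Fin (2 * n + 1) => et i.castSucc)) ∧
    -- … and restriction to E is a surjective group homomorphism P → Sp_{2n+1}(ω)
    (∃ φ : ↥(sympGroup ωt ⊓ stabSubgroup (Submodule.span ℂ {et 0})) →*
        ↥(sympGroup (ωt.restrict
          (Submodule.span ℂ (Set.range fun i : Fin (2 * n + 1) => et i.castSucc)))),
      (∀ (g : ↥(sympGroup ωt ⊓ stabSubgroup (Submodule.span ℂ {et 0})))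
          (x : ↥(Submodule.span ℂ (Set.range fun i : Fin (2 * n + 1) => et i.castSucc))),
        (((φ g : ↥(Submodule.span ℂ (Set.range fun i : Fin (2 * n + 1) => et i.castSucc)) ≃ₗ[ℂ]
            ↥(Submodule.span ℂ (Set.range fun i : Fin (2 * n + 1) => et i.castSucc))) x : _) : Et)
          = (g : Et ≃ₗ[ℂ] Et) (x : Et)) ∧
      Function.Surjective φ) := by
  have hB := eq_zero_of_forall_apply_eq_zero_of_symplecticBasis halt et het
  have hH := mem_span_symplecticBasis_castSucc_iff halt et het
  have hef : ωt (et 0) (et (Fin.last _)) = 1 := by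
    rw [het _ _ (by simp), if_pos (by simp)]
  have hmap := fun g hg =>
    map_orthogonal_eq_of_mem_stabSubgroup (g := g) (et.ne_zero 0) hH hg
  refine ⟨hmap, sympGroupRestrict ωt _ inf_le_left _ hmap, fun _ _ => rfl, ?_⟩
  rintro ⟨g, hg⟩
  obtain ⟨G, hG, hGg⟩ := exists_extension_of_mem_sympGroup_restrict halt hB hH hef hg
  refine ⟨⟨G, hG, mem_stabSubgroup_span_singleton_of_extends hB hH hef hG hGg⟩, ?_⟩
  exact Subtype.ext <| LinearEquiv.ext fun x => Subtype.ext (hGg x)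

end
end

section
/- For every integer k with 1 ≤ k ≤ n, the natural action of Sp_{2n+1}(ω) on the set of k-dimensional isotropic subspaces of E has exactly two orbits, namely X_0 = {V : dim V = k, V isotropic, e_0 ∈ V} and X_1 = {V : dim V = k, V isotropic, e_0 ∉ V}; both sets are nonempty and Sp_{2n+1}(ω) acts transitively on each. -/
open Module Submodule

noncomputable section

variable {E : Type*} [AddCommGroup E] [Module ℂ E]

/-- A subspace is isotropic for a bilinear form. -/
def IsIsotropic (ω : LinearMap.BilinForm ℂ E) (V : Submodule ℂ E) : Prop :=
  ∀ x ∈ V, ∀ y ∈ V, ω x y = 0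

/-- Two finite families are dual isotropic families for a bilinear form. -/
def IsDarboux {ι : Type*} [DecidableEq ι] (ω : LinearMap.BilinForm ℂ E) (e f : ι → E) : Prop :=
  (∀ i j, ω (e i) (e j) = 0) ∧ (∀ i j, ω (f i) (f j) = 0) ∧
    ∀ i j, ω (e i) (f j) = if i = j then 1 else 0

theorem LinearIndependent.exists_dual_family {ι K M : Type*} [DecidableEq ι] [Field K]
    [AddCommGroup M] [Module K M] {u : ι → M} (hu : LinearIndependent K u) :
    ∃ F : ι → Dual K M, ∀ i j, F j (u i) = if i = j then 1 else 0 := by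
  obtain ⟨g, hg⟩ := (Finsupp.linearCombination K u).exists_leftInverse_of_injective
    (LinearMap.ker_eq_bot.mpr hu)
  refine ⟨fun j => (Finsupp.lapply j) ∘ₗ g, fun i j => ?_⟩
  have h := LinearMap.congr_fun hg (Finsupp.single i 1)
  simp only [LinearMap.comp_apply, Finsupp.linearCombination_single, one_smul,
    LinearMap.id_apply] at h
  simp [h, Finsupp.single_apply]

theorem exists_isDarboux_of_linearIndependent [FiniteDimensional ℂ E] {ι : Type*} [Fintype ι]
    [DecidableEq ι] {ω : LinearMap.BilinForm ℂ E} (halt : ω.IsAlt) {e : ι → E}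
    (he : LinearIndependent ℂ e) (hiso : IsIsotropic ω (span ℂ (Set.range e)))
    (hdisj : Disjoint (span ℂ (Set.range e)) (LinearMap.ker ω)) :
    ∃ f : ι → E, IsDarboux ω e f := by
  have hu : LinearIndependent ℂ (ω ∘ e) := he.map hdisj
  obtain ⟨F, hF⟩ := hu.exists_dual_family
  have hx (j : ι) : ∃ x : E, ∀ i, ω (e i) x = if i = j then 1 else 0 := by
    refine ⟨(evalEquiv ℂ E).symm (F j), fun i => ?_⟩
    rw [apply_evalEquiv_symm_apply]
    exact hF i j
  choose x hx using hx
  have hee (i j : ι) : ω (e i) (e j) = 0 :=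
    hiso _ (subset_span ⟨i, rfl⟩) _ (subset_span ⟨j, rfl⟩)
  have hxe (i j : ι) : ω (x j) (e i) = -(if i = j then 1 else 0) := by
    rw [← hx j i, halt.neg_eq]
  refine ⟨fun j => x j + ∑ i, (-(1 / 2 : ℂ) * ω (x j) (x i)) • e i, hee, fun i j => ?_,
    fun i j => ?_⟩
  · simp only [map_add, LinearMap.add_apply, map_sum, LinearMap.sum_apply, map_smul,
      LinearMap.smul_apply, smul_eq_mul, hee, hx, hxe, mul_neg, mul_ite, mul_one, mul_zero,
      Finset.sum_neg_distrib, Finset.sum_ite_eq', Finset.mem_univ, if_true,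
      Finset.sum_const_zero, add_zero]
    rw [← halt.neg_eq (x i) (x j)]
    ring
  · simp [hx, hee]

theorem IsIsotropic.sup_span_singleton {ω : LinearMap.BilinForm ℂ E} (halt : ω.IsAlt)
    {V : Submodule ℂ E} (hV : IsIsotropic ω V) {x : E} (hx : ∀ v ∈ V, ω v x = 0) :
    IsIsotropic ω (V ⊔ span ℂ {x}) := by
  have hx' (v : E) (hv : v ∈ V) : ω x v = 0 := by rw [← halt.neg_eq, hx v hv, neg_zero]
  intro y hy z hz
  obtain ⟨v, hv, _, ha, rfl⟩ := mem_sup.mp hy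
  obtain ⟨a, rfl⟩ := mem_span_singleton.mp ha
  obtain ⟨w, hw, _, hb, rfl⟩ := mem_sup.mp hz
  obtain ⟨b, rfl⟩ := mem_span_singleton.mp hb
  simp [hV v hv w hw, hx v hv, hx' w hw, halt.self_eq_zero]

theorem IsIsotropic.mono {ω : LinearMap.BilinForm ℂ E} {V W : Submodule ℂ E}
    (hW : IsIsotropic ω W) (h : V ≤ W) : IsIsotropic ω V :=
  fun x hx y hy => hW x (h hx) y (h hy)

theorem IsIsotropic.exists_le_maximal [FiniteDimensional ℂ E] {ω : LinearMap.BilinForm ℂ E}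
    {V : Submodule ℂ E} (hV : IsIsotropic ω V) (hdisj : Disjoint V (LinearMap.ker ω)) :
    ∃ L, V ≤ L ∧ Maximal (fun M => IsIsotropic ω M ∧ Disjoint M (LinearMap.ker ω)) L := by
  obtain ⟨L, hL, hmax⟩ := wellFounded_gt.has_min
    {M : Submodule ℂ E | V ≤ M ∧ IsIsotropic ω M ∧ Disjoint M (LinearMap.ker ω)}
    ⟨V, le_rfl, hV, hdisj⟩
  refine ⟨L, hL.1, hL.2, fun M hM hLM => ?_⟩
  by_contra h
  exact hmax M ⟨hL.1.trans hLM, hM⟩ (lt_of_le_not_ge hLM h)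

theorem IsDarboux.linearIndependent {ι : Type*} [Fintype ι] [DecidableEq ι]
    {ω : LinearMap.BilinForm ℂ E} (halt : ω.IsAlt) {e f : ι → E} (h : IsDarboux ω e f)
    {e₀ : E} (he₀ : e₀ ≠ 0) (hker : e₀ ∈ LinearMap.ker ω) :
    LinearIndependent ℂ (Sum.elim e (Sum.elim f fun _ : Unit => e₀)) := by
  obtain ⟨hee, hff, hef⟩ := h
  have hfe (i j : ι) : ω (f i) (e j) = -(if j = i then 1 else 0) := by
    rw [← hef, halt.neg_eq]
  have h0 : ω e₀ = 0 := hker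
  rw [Fintype.linearIndependent_iff]
  intro g hg
  simp only [Fintype.sum_sum_type, Sum.elim_inl, Sum.elim_inr, Finset.univ_unique,
    Finset.sum_singleton] at hg
  have h1 (i : ι) : g (.inl i) = 0 := by
    simpa [hee, hff, hef, hfe, h0] using congrArg (fun y => ω y (f i)) hg
  have h2 (i : ι) : g (.inr (.inl i)) = 0 := by
    simpa [hee, hff, hef, hfe, h0] using congrArg (fun y => ω y (e i)) hg
  have h3 : g (.inr (.inr ())) = 0 := by simpa [h1, h2, he₀] using hg
  rintro (i | i | i)
  exacts [h1 i, h2 i, h3]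

theorem IsDarboux.top_le_span {ι : Type*} [Fintype ι] [DecidableEq ι]
    {ω : LinearMap.BilinForm ℂ E} (halt : ω.IsAlt) {e f : ι → E} (h : IsDarboux ω e f)
    {e₀ : E} (hker : LinearMap.ker ω = span ℂ {e₀})
    (hmax : Maximal (fun M => IsIsotropic ω M ∧ Disjoint M (LinearMap.ker ω))
      (span ℂ (Set.range e))) :
    ⊤ ≤ span ℂ (Set.range (Sum.elim e (Sum.elim f fun _ : Unit => e₀))) := by
  obtain ⟨hee, hff, hef⟩ := h
  have hfe (i j : ι) : ω (f i) (e j) = -(if j = i then 1 else 0) := by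
    rw [← hef, halt.neg_eq]
  intro x _
  obtain ⟨y, hy⟩ : ∃ y, y = x - ∑ i, ω x (f i) • e i + ∑ i, ω x (e i) • f i := ⟨_, rfl⟩
  have hye (j : ι) : ω y (e j) = 0 := by simp [hy, hee, hfe]
  have hyf (j : ι) : ω y (f j) = 0 := by simp [hy, hff, hef]
  have hLy : ∀ v ∈ span ℂ (Set.range e), ω v y = 0 := by
    intro v hv
    rw [← halt.neg_eq, neg_eq_zero]
    have hle : span ℂ (Set.range e) ≤ LinearMap.ker (ω y) := by
      rw [span_le]
      rintro _ ⟨j, rfl⟩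
      exact hye j
    exact hle hv
  have hcoeff : ∀ v ∈ span ℂ (Set.range e), (∀ j, ω v (f j) = 0) → v = 0 := by
    intro v hv hvf
    obtain ⟨c, rfl⟩ := (mem_span_range_iff_exists_fun ℂ).mp hv
    refine Finset.sum_eq_zero fun i _ => ?_
    have := hvf i
    simp only [map_sum, LinearMap.sum_apply, map_smul, LinearMap.smul_apply, hef, smul_eq_mul,
      mul_ite, mul_one, mul_zero, Finset.sum_ite_eq', Finset.mem_univ, if_true] at this
    rw [this, zero_smul]
  have hyker : y ∈ LinearMap.ker ω := by
    by_contra hyk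
    have hM : Disjoint (span ℂ (Set.range e) ⊔ span ℂ {y}) (LinearMap.ker ω) := by
      rw [disjoint_def]
      intro z hz hzk
      obtain ⟨v, hv, _, ha, rfl⟩ := mem_sup.mp hz
      obtain ⟨a, rfl⟩ := mem_span_singleton.mp ha
      have hzero : ω (v + a • y) = 0 := hzk
      have hv0 : v = 0 := hcoeff v hv fun j => by
        simpa [hyf] using LinearMap.congr_fun hzero (f j)
      subst hv0
      rw [zero_add] at hzk ⊢
      by_contra ha
      exact hyk (((LinearMap.ker ω).smul_mem_iff (left_ne_zero_of_smul ha)).mp hzk)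
    have hyL : y ∈ span ℂ (Set.range e) :=
      hmax.2 ⟨hmax.1.1.sup_span_singleton halt hLy, hM⟩ le_sup_left
        (mem_sup_right (mem_span_singleton_self y))
    exact hyk (hcoeff y hyL hyf ▸ zero_mem _)
  rw [hker, mem_span_singleton] at hyker
  obtain ⟨a, ha⟩ := hyker
  have hx : x = a • e₀ + ∑ i, ω x (f i) • e i - ∑ i, ω x (e i) • f i := by
    rw [ha, hy]; abel
  rw [hx]
  refine sub_mem (add_mem (smul_mem _ _ (subset_span ⟨.inr (.inr ()), rfl⟩))
    (sum_mem fun i _ => smul_mem _ _ (subset_span ⟨.inl i, rfl⟩)))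
    (sum_mem fun i _ => smul_mem _ _ (subset_span ⟨.inr (.inl i), rfl⟩))

/-- An isotropic subspace missing the kernel is spanned by the first vectors of a
Darboux basis. -/
theorem IsIsotropic.exists_darboux_basis [FiniteDimensional ℂ E] {n k : ℕ}
    (hdim : finrank ℂ E = 2 * n + 1) {ω : LinearMap.BilinForm ℂ E} (halt : ω.IsAlt)
    {e₀ : E} (he₀ : e₀ ≠ 0) (hker : LinearMap.ker ω = span ℂ {e₀})
    {V : Submodule ℂ E} (hV : IsIsotropic ω V) (hVk : finrank ℂ V = k) (hV₀ : e₀ ∉ V) :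
    k ≤ n ∧ ∃ e f : Fin k ⊕ Fin (n - k) → E, IsDarboux ω e f ∧
      span ℂ (Set.range (e ∘ Sum.inl)) = V ∧
      ∃ b : Basis ((Fin k ⊕ Fin (n - k)) ⊕ (Fin k ⊕ Fin (n - k)) ⊕ Unit) ℂ E,
        ⇑b = Sum.elim e (Sum.elim f fun _ => e₀) := by
  have hdisj : Disjoint V (LinearMap.ker ω) := by
    rw [hker, disjoint_span_singleton' he₀]
    exact hV₀
  obtain ⟨L, hVL, hmax⟩ := hV.exists_le_maximal hdisj
  obtain ⟨C, hVC, rfl⟩ := IsModularLattice.exists_disjoint_and_sup_eq hVL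
  have hrange {m : ℕ} {U : Submodule ℂ E} (b : Basis (Fin m) ℂ U) :
      span ℂ (Set.range (U.subtype ∘ b)) = U := by
    rw [Set.range_comp, span_image, b.span_eq, Submodule.map_top, range_subtype]
  obtain ⟨m, hm⟩ : ∃ m, finrank ℂ C = m := ⟨_, rfl⟩
  let bV := finBasisOfFinrankEq ℂ V hVk
  let bC := finBasisOfFinrankEq ℂ C hm
  obtain ⟨e, he⟩ : ∃ e, e = Sum.elim (V.subtype ∘ bV) (C.subtype ∘ bC) := ⟨_, rfl⟩
  have hspan : span ℂ (Set.range e) = V ⊔ C := by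
    rw [he, Set.Sum.elim_range, span_union, hrange, hrange]
  have hli : LinearIndependent ℂ e := by
    rw [he]
    refine LinearIndependent.sum_type (bV.linearIndependent.map' _ V.ker_subtype)
      (bC.linearIndependent.map' _ C.ker_subtype) ?_
    rw [hrange, hrange]
    exact hVC
  rw [← hspan] at hmax
  obtain ⟨f, hf⟩ := exists_isDarboux_of_linearIndependent halt hli hmax.1.1 hmax.1.2
  have hb := hf.linearIndependent halt he₀ (hker ▸ mem_span_singleton_self e₀)
  let b := Basis.mk hb (hf.top_le_span halt hker hmax)
  have hcard := finrank_eq_card_basis b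
  simp only [Fintype.card_sum, Fintype.card_fin, Fintype.card_unit, hdim] at hcard
  obtain rfl : m = n - k := by omega
  refine ⟨by omega, e, f, hf, ?_, b, Basis.coe_mk _ _⟩
  rw [he, Sum.elim_comp_inl, hrange]

theorem exists_mem_sympGroup_map_eq_of_notMem [FiniteDimensional ℂ E] {n k : ℕ}
    (hdim : finrank ℂ E = 2 * n + 1) {ω : LinearMap.BilinForm ℂ E} (halt : ω.IsAlt)
    {e₀ : E} (he₀ : e₀ ≠ 0) (hker : LinearMap.ker ω = span ℂ {e₀})
    {V W : Submodule ℂ E} (hVk : finrank ℂ V = k) (hV : IsIsotropic ω V) (hV₀ : e₀ ∉ V)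
    (hWk : finrank ℂ W = k) (hW : IsIsotropic ω W) (hW₀ : e₀ ∉ W) :
    ∃ g ∈ sympGroup ω, g e₀ = e₀ ∧
      Submodule.map ((g : E ≃ₗ[ℂ] E) : E →ₗ[ℂ] E) V = W := by
  obtain ⟨-, e, f, ⟨hee, hff, hef⟩, rfl, b, hb⟩ :=
    hV.exists_darboux_basis hdim halt he₀ hker hVk hV₀
  obtain ⟨-, e', f', ⟨hee', hff', hef'⟩, rfl, b', hb'⟩ :=
    hW.exists_darboux_basis hdim halt he₀ hker hWk hW₀
  have h0 : ω e₀ = 0 := (hker ▸ mem_span_singleton_self e₀ : e₀ ∈ LinearMap.ker ω)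
  have h0' (x : E) : ω x e₀ = 0 := by rw [← halt.neg_eq, h0]; simp
  have hfe (i j) : ω (f i) (e j) = -(if j = i then 1 else 0) := by
    rw [← hef, halt.neg_eq]
  have hfe' (i j) : ω (f' i) (e' j) = -(if j = i then 1 else 0) := by
    rw [← hef', halt.neg_eq]
  obtain ⟨g, hg⟩ : ∃ g : E ≃ₗ[ℂ] E, ∀ i, g (b i) = b' i :=
    ⟨b.equiv b' (Equiv.refl _), fun i => by simp⟩
  rw [hb, hb'] at hg
  have hge (i) : g (e i) = e' i := hg (.inl i)
  have hgf (i) : g (f i) = f' i := hg (.inr (.inl i))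
  have hg0 : g e₀ = e₀ := hg (.inr (.inr ()))
  refine ⟨g, ?_, hg0, ?_⟩
  · have : ω.compl₁₂ (g : E →ₗ[ℂ] E) (g : E →ₗ[ℂ] E) = ω := by
      refine LinearMap.BilinForm.ext_basis b fun i j => ?_
      rw [hb]
      rcases i with i | i | i <;> rcases j with j | j | j <;>
        simp [hge, hgf, hg0, h0, h0', hee, hff, hef, hfe, hee', hff', hef', hfe']
    exact fun x y => LinearMap.congr_fun₂ this x y
  · rw [← span_image, ← Set.range_comp]
    congr 2
    funext i
    exact hge _

theorem IsIsotropic.exists_sup_span_singleton_eq [FiniteDimensional ℂ E] {k : ℕ}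
    {ω : LinearMap.BilinForm ℂ E} {e₀ : E} (he₀ : e₀ ≠ 0) {V : Submodule ℂ E}
    (hV : IsIsotropic ω V) (hVk : finrank ℂ V = k) (hV₀ : e₀ ∈ V) :
    ∃ U : Submodule ℂ E, finrank ℂ U = k - 1 ∧ IsIsotropic ω U ∧ e₀ ∉ U ∧
      U ⊔ span ℂ {e₀} = V := by
  obtain ⟨U, hU, rfl⟩ := IsModularLattice.exists_disjoint_and_sup_eq
    ((span_singleton_le_iff_mem e₀ V).mpr hV₀)
  have h := finrank_sup_add_finrank_inf_eq (span ℂ {e₀}) U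
  rw [hU.eq_bot, finrank_bot, finrank_span_singleton he₀] at h
  exact ⟨U, by omega, hV.mono le_sup_right, (disjoint_span_singleton' he₀).mp hU.symm,
    sup_comm _ _⟩

theorem exists_isIsotropic_notMem [FiniteDimensional ℂ E] {n k : ℕ} (hkn : k ≤ n)
    (hdim : finrank ℂ E = 2 * n + 1) {ω : LinearMap.BilinForm ℂ E} (halt : ω.IsAlt)
    {e₀ : E} (he₀ : e₀ ≠ 0) (hker : LinearMap.ker ω = span ℂ {e₀}) :
    ∃ V : Submodule ℂ E, finrank ℂ V = k ∧ IsIsotropic ω V ∧ e₀ ∉ V := by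
  have hbot : IsIsotropic ω (⊥ : Submodule ℂ E) := by
    rintro x hx y -
    rw [(mem_bot ℂ).mp hx]
    simp
  obtain ⟨-, e, f, hef, -, b, hb⟩ :=
    hbot.exists_darboux_basis hdim halt he₀ hker (finrank_bot ℂ E) (by simpa using he₀)
  let φ : Fin k → Fin 0 ⊕ Fin (n - 0) := fun i => .inr (i.castLE hkn)
  have hφ : Function.Injective φ := fun i j h => by simpa [φ] using h
  have hli : LinearIndependent ℂ (e ∘ φ) := by
    have := b.linearIndependent.comp (Sum.inl ∘ φ) (Sum.inl_injective.comp hφ)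
    rwa [hb] at this
  have hiso : ∀ v ∈ span ℂ (Set.range (e ∘ φ)), ∀ w ∈ span ℂ (Set.range (e ∘ φ)),
      ω v w = 0 := by
    intro v hv w hw
    obtain ⟨c, rfl⟩ := (mem_span_range_iff_exists_fun ℂ).mp hv
    obtain ⟨d, rfl⟩ := (mem_span_range_iff_exists_fun ℂ).mp hw
    simp [hef.1]
  refine ⟨span ℂ (Set.range (e ∘ φ)), by simp [finrank_span_eq_card hli], hiso, ?_⟩
  have h := b.linearIndependent.notMem_span_image (s := Set.range (Sum.inl ∘ φ))
    (x := .inr (.inr ())) (by simp)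
  rw [← Set.range_comp, hb] at h
  exact h

/-- For `1 ≤ k ≤ n`, the odd symplectic group acts on the set of
`k`-dimensional isotropic subspaces of `E` with exactly two orbits:
`X₀ = {V : e₀ ∈ V}` and `X₁ = {V : e₀ ∉ V}`; both are nonempty, the incidence with `e₀`
is invariant under the action, and the group acts transitively on each of the two sets. -/
theorem odd_symplectic_grassmannian_orbits
    (n k : ℕ) (hn : 1 ≤ n) (hk1 : 1 ≤ k) (hkn : k ≤ n)
    [FiniteDimensional ℂ E] (hdim : finrank ℂ E = 2 * n + 1)
    (ω : LinearMap.BilinForm ℂ E) (halt : ω.IsAlt)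
    (e₀ : E) (he₀ : e₀ ≠ 0) (hker : LinearMap.ker ω = Submodule.span ℂ {e₀}) :
    -- X₀ is nonempty
    (∃ V : Submodule ℂ E, finrank ℂ V = k ∧ IsIsotropic ω V ∧ e₀ ∈ V) ∧
    -- X₁ is nonempty
    (∃ V : Submodule ℂ E, finrank ℂ V = k ∧ IsIsotropic ω V ∧ e₀ ∉ V) ∧
    -- the two sets are stable under the action of the odd symplectic group
    (∀ g ∈ sympGroup ω, ∀ V : Submodule ℂ E, finrank ℂ V = k → IsIsotropic ω V →
      (e₀ ∈ V ↔ e₀ ∈ Submodule.map (g : E →ₗ[ℂ] E) V)) ∧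
    -- the action is transitive on X₀ …
    (∀ V W : Submodule ℂ E,
      finrank ℂ V = k → IsIsotropic ω V → e₀ ∈ V →
      finrank ℂ W = k → IsIsotropic ω W → e₀ ∈ W →
      ∃ g ∈ sympGroup ω, Submodule.map ((g : E ≃ₗ[ℂ] E) : E →ₗ[ℂ] E) V = W) ∧
    -- … and on X₁
    (∀ V W : Submodule ℂ E,
      finrank ℂ V = k → IsIsotropic ω V → e₀ ∉ V →
      finrank ℂ W = k → IsIsotropic ω W → e₀ ∉ W →
      ∃ g ∈ sympGroup ω, Submodule.map ((g : E ≃ₗ[ℂ] E) : E →ₗ[ℂ] E) V = W) := by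
  have h0 : ω e₀ = 0 := (hker ▸ mem_span_singleton_self e₀ : e₀ ∈ LinearMap.ker ω)
  have h0' (x : E) : ω x e₀ = 0 := by rw [← halt.neg_eq, h0]; simp
  refine ⟨?_, exists_isIsotropic_notMem hkn hdim halt he₀ hker, ?_, ?_, ?_⟩
  · obtain ⟨U, hUk, hU, hU₀⟩ :=
      exists_isIsotropic_notMem (k := k - 1) (by omega) hdim halt he₀ hker
    refine ⟨U ⊔ span ℂ {e₀}, ?_, hU.sup_span_singleton halt fun v _ => h0' v,
      mem_sup_right (mem_span_singleton_self e₀)⟩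
    have h := finrank_sup_add_finrank_inf_eq U (span ℂ {e₀})
    rw [((disjoint_span_singleton' he₀).mpr hU₀).eq_bot, finrank_bot,
      finrank_span_singleton he₀] at h
    omega
  · intro g hg V _ _
    have hge : g e₀ ∈ LinearMap.ker ω := by
      rw [LinearMap.mem_ker]
      ext y
      obtain ⟨x, rfl⟩ := g.surjective y
      rw [hg e₀ x, h0]
      simp
    rw [hker, mem_span_singleton] at hge
    obtain ⟨a, ha⟩ := hge
    have ha0 : a ≠ 0 := by
      rintro rfl
      rw [zero_smul] at ha
      exact he₀ (g.map_eq_zero_iff.mp ha.symm)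
    rw [← (V.map (g : E →ₗ[ℂ] E)).smul_mem_iff ha0, ha]
    exact ⟨fun h => mem_map_of_mem h, fun ⟨v, hv, hvg⟩ => g.injective hvg ▸ hv⟩
  · intro V W hVk hV hV₀ hWk hW hW₀
    obtain ⟨V', hVk', hV', hV₀', rfl⟩ := hV.exists_sup_span_singleton_eq he₀ hVk hV₀
    obtain ⟨W', hWk', hW', hW₀', rfl⟩ := hW.exists_sup_span_singleton_eq he₀ hWk hW₀
    obtain ⟨g, hg, hg₀, hmap⟩ := exists_mem_sympGroup_map_eq_of_notMem hdim halt he₀ hker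
      hVk' hV' hV₀' hWk' hW' hW₀'
    refine ⟨g, hg, ?_⟩
    rw [Submodule.map_sup, hmap, map_span, Set.image_singleton]
    simp [hg₀]
  · intro V W hVk hV hV₀ hWk hW hW₀
    obtain ⟨g, hg, -, hmap⟩ := exists_mem_sympGroup_map_eq_of_notMem hdim halt he₀ hker
      hVk hV hV₀ hWk hW hW₀
    exact ⟨g, hg, hmap⟩

end
end

section
/- The map V ↦ V ∩ F is a bijection from the set of (n+1)-dimensional isotropic subspaces of E onto the set of n-dimensional isotropic subspaces of F, with inverse W ↦ ℂe_0 ⊕ W; in particular, every (n+1)-dimensional isotropic subspace of E contains e_0. -/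
open Module Submodule

noncomputable section

variable {E : Type*} [AddCommGroup E] [Module ℂ E]

section OddSymplecticBasis

variable {n : ℕ} {ω : LinearMap.BilinForm ℂ E} {e : Basis (Fin (2 * n + 1)) ℂ E}

/-- Vectors of an odd symplectic basis pair nontrivially exactly when their indices add up to
`2 * n + 1`. -/
lemma oddSymplecticBasis_apply_eq_zero_iff (halt : ω.IsAlt)
    (he : ∀ i j : Fin (2 * n + 1), (i : ℕ) < (j : ℕ) →
      ω (e i) (e j) = if (i : ℕ) + (j : ℕ) = 2 * n + 1 then 1 else 0)
    (i j : Fin (2 * n + 1)) :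
    ω (e i) (e j) = 0 ↔ (i : ℕ) + (j : ℕ) ≠ 2 * n + 1 := by
  rcases lt_trichotomy (i : ℕ) (j : ℕ) with h | h | h
  · rw [he i j h]
    simp
  · obtain rfl : i = j := Fin.ext h
    refine iff_of_true (halt.self_eq_zero _) ?_
    lia
  · rw [halt.eq_iff, he j i h, add_comm]
    simp

/-- The kernel of the form is the line spanned by the first vector of an odd symplectic basis. -/
lemma ker_eq_span_oddSymplecticBasis_zero (halt : ω.IsAlt)
    (he : ∀ i j : Fin (2 * n + 1), (i : ℕ) < (j : ℕ) →
      ω (e i) (e j) = if (i : ℕ) + (j : ℕ) = 2 * n + 1 then 1 else 0) :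
    LinearMap.ker ω = span ℂ {e 0} := by
  have pair := oddSymplecticBasis_apply_eq_zero_iff halt he
  refine le_antisymm (fun x hx => ?_) ?_
  · have repr_eq_zero : ∀ i, i ≠ 0 → e.repr x i = 0 := by
      intro i hi
      have hi' : (i : ℕ) ≠ 0 := fun h => hi (Fin.ext h)
      let j : Fin (2 * n + 1) := ⟨2 * n + 1 - i, by lia⟩
      have hj : (j : ℕ) = 2 * n + 1 - i := rfl
      have hxj : ω (∑ k, e.repr x k • e k) (e j) = 0 := by
        rw [e.sum_repr, LinearMap.mem_ker.mp hx, LinearMap.zero_apply]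
      simp only [map_sum, map_smul, LinearMap.sum_apply, LinearMap.smul_apply,
        smul_eq_mul] at hxj
      rw [Finset.sum_eq_single i] at hxj
      · refine (mul_eq_zero.mp hxj).resolve_right fun h => (pair i j).mp h ?_
        lia
      · intro k _ hk
        have hk' : (k : ℕ) ≠ i := fun h => hk (Fin.ext h)
        rw [(pair k j).mpr (by lia), mul_zero]
      · simp
    rw [← e.sum_repr x, Finset.sum_eq_single 0 (fun i _ hi => by rw [repr_eq_zero i hi, zero_smul])
      (by simp)]
    exact smul_mem _ _ (mem_span_singleton_self _)
  · rw [span_singleton_le_iff_mem, LinearMap.mem_ker]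
    refine e.ext fun j => (pair 0 j).mpr ?_
    have := j.isLt
    simp only [Fin.val_zero]
    lia

/-- `Fsub n e` is a complement of the line spanned by `e 0`. -/
lemma isCompl_span_zero_Fsub (e : Basis (Fin (2 * n + 1)) ℂ E) :
    IsCompl (span ℂ {e 0}) (Fsub n e) := by
  constructor
  · rw [disjoint_comm, disjoint_span_singleton' (e.ne_zero 0)]
    have h := e.linearIndependent.notMem_span_image (s := Set.range Fin.succ) (x := 0)
      (by rintro ⟨i, hi⟩; exact Fin.succ_ne_zero i hi)
    rwa [← Set.range_comp] at h
  · rw [codisjoint_iff, Fsub, ← span_union, ← e.span_eq, Fin.range_fin_succ]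
    rfl

end OddSymplecticBasis

/-- An isotropic subspace of dimension more than half of the ambient dimension meets the kernel of
the form. -/
lemma IsIsotropic.inf_ker_ne_bot [FiniteDimensional ℂ E] {ω : LinearMap.BilinForm ℂ E}
    {V : Submodule ℂ E} (hV : IsIsotropic ω V) (hdim : finrank ℂ E < 2 * finrank ℂ V) :
    V ⊓ LinearMap.ker ω ≠ ⊥ := by
  intro h
  have hle : finrank ℂ V ≤ finrank ℂ (ω.orthogonal V) :=
    finrank_mono fun x hx y hy => hV y hy x hx
  have hsum := LinearMap.BilinForm.finrank_add_finrank_orthogonal' (B := ω) V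
  rw [h, finrank_bot] at hsum
  lia

/-- Adding vectors of the kernel of an alternating form keeps a subspace isotropic. -/
lemma IsIsotropic.sup_of_le_ker {ω : LinearMap.BilinForm ℂ E} (halt : ω.IsAlt)
    {K W : Submodule ℂ E} (hW : IsIsotropic ω W) (hK : K ≤ LinearMap.ker ω) :
    IsIsotropic ω (K ⊔ W) := by
  intro x hx y hy
  obtain ⟨a, ha, w, hw, rfl⟩ := mem_sup.mp hx
  obtain ⟨b, hb, v, hv, rfl⟩ := mem_sup.mp hy
  have ker_left : ∀ c ∈ K, ∀ z, ω c z = 0 := fun c hc z => by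
    rw [LinearMap.mem_ker.mp (hK hc), LinearMap.zero_apply]
  rw [map_add, map_add, LinearMap.add_apply, LinearMap.add_apply, ker_left a ha, ker_left a ha,
    halt.eq_iff.mp (ker_left b hb w), hW w hw v hv]
  simp

/-- The map `V ↦ V ∩ F` is a bijection from the set of
`(n+1)`-dimensional isotropic subspaces of `E` onto the set of `n`-dimensional
isotropic subspaces of `F`, with inverse `W ↦ ℂe₀ ⊕ W`; in particular every
`(n+1)`-dimensional isotropic subspace of `E` contains `e₀`. -/
theorem maximal_isotropic_bijection
    (n : ℕ) (hn : 1 ≤ n) [FiniteDimensional ℂ E] (hdim : finrank ℂ E = 2 * n + 1)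
    (ω : LinearMap.BilinForm ℂ E) (halt : ω.IsAlt)
    (e : Basis (Fin (2 * n + 1)) ℂ E)
    (he : ∀ i j : Fin (2 * n + 1), (i : ℕ) < (j : ℕ) →
      ω (e i) (e j) = if (i : ℕ) + (j : ℕ) = 2 * n + 1 then 1 else 0) :
    -- every (n+1)-dimensional isotropic subspace contains e₀
    (∀ V : Submodule ℂ E, finrank ℂ V = n + 1 → IsIsotropic ω V → e 0 ∈ V) ∧
    -- V ↦ V ∩ F maps into n-dimensional isotropic subspaces of F …
    (∀ V : Submodule ℂ E, finrank ℂ V = n + 1 → IsIsotropic ω V →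
      (V ⊓ Fsub n e ≤ Fsub n e ∧ finrank ℂ ↥(V ⊓ Fsub n e) = n ∧
        IsIsotropic ω (V ⊓ Fsub n e))) ∧
    -- … with W ↦ ℂe₀ ⊕ W as a two-sided inverse
    (∀ V : Submodule ℂ E, finrank ℂ V = n + 1 → IsIsotropic ω V →
      Submodule.span ℂ {e 0} ⊔ (V ⊓ Fsub n e) = V) ∧
    (∀ W : Submodule ℂ E, W ≤ Fsub n e → finrank ℂ W = n → IsIsotropic ω W →
      (Submodule.span ℂ {e 0} ⊓ W = ⊥ ∧
        finrank ℂ ↥(Submodule.span ℂ {e 0} ⊔ W) = n + 1 ∧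
        IsIsotropic ω (Submodule.span ℂ {e 0} ⊔ W) ∧
        (Submodule.span ℂ {e 0} ⊔ W) ⊓ Fsub n e = W)) := by
  have hker := ker_eq_span_oddSymplecticBasis_zero halt he
  have hcompl := isCompl_span_zero_Fsub e
  have hline : finrank ℂ (span ℂ {e 0}) = 1 := finrank_span_singleton (e.ne_zero 0)
  have finrank_sup : ∀ W ≤ Fsub n e, finrank ℂ ↥(span ℂ {e 0} ⊔ W) = finrank ℂ W + 1 := by
    intro W hW
    have h := finrank_sup_add_finrank_inf_eq (span ℂ {e 0}) W
    rw [(hcompl.disjoint.mono_right hW).eq_bot, finrank_bot, hline] at h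
    lia
  have mem : ∀ V : Submodule ℂ E, finrank ℂ V = n + 1 → IsIsotropic ω V → e 0 ∈ V := by
    intro V hV hiso
    by_contra h
    refine hiso.inf_ker_ne_bot (by lia) ?_
    rw [hker]
    exact ((disjoint_span_singleton' (e.ne_zero 0)).mpr h).eq_bot
  have sup_inf : ∀ V : Submodule ℂ E, finrank ℂ V = n + 1 → IsIsotropic ω V →
      span ℂ {e 0} ⊔ (V ⊓ Fsub n e) = V := by
    intro V hV hiso
    rw [inf_comm, ← sup_inf_assoc_of_le _ ((span_singleton_le_iff_mem _ _).mpr (mem V hV hiso)),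
      hcompl.sup_eq_top, top_inf_eq]
  refine ⟨mem, fun V hV hiso => ⟨inf_le_right, ?_, fun x hx y hy => hiso x hx.1 y hy.1⟩, sup_inf,
    fun W hW hdimW hiso => ⟨(hcompl.disjoint.mono_right hW).eq_bot, ?_,
      hiso.sup_of_le_ker halt hker.ge, ?_⟩⟩
  · have h := finrank_sup (V ⊓ Fsub n e) inf_le_right
    rw [sup_inf V hV hiso] at h
    lia
  · rw [finrank_sup W hW, hdimW]
  · rw [sup_comm, sup_inf_assoc_of_le _ hW, hcompl.inf_eq_bot, sup_bot_eq]

end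
end

section
/- The natural action of Sp_{2n+1}(ω) on the set of complete isotropic flags of E has exactly n+1 orbits, namely the sets O_i = {(V_1 ⊂ … ⊂ V_{n+1}) : e_0 ∈ V_i and e_0 ∉ V_{i−1}} for 1 ≤ i ≤ n+1 (with the convention V_0 = 0); these sets partition the set of complete isotropic flags and Sp_{2n+1}(ω) acts transitively on each. -/
open Module Submodule

noncomputable section

variable {E : Type*} [AddCommGroup E] [Module ℂ E]

/-- A complete isotropic flag `V₁ ⊂ … ⊂ V_{n+1}` of `E` (indexed so that `V i` has
dimension `i+1`). -/
def IsIsoFlag (n : ℕ) (ω : LinearMap.BilinForm ℂ E)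
    (V : Fin (n + 1) → Submodule ℂ E) : Prop :=
  (∀ i j : Fin (n + 1), i ≤ j → V i ≤ V j) ∧
  (∀ i : Fin (n + 1), finrank ℂ (V i) = (i : ℕ) + 1) ∧
  (∀ i : Fin (n + 1), IsIsotropic ω (V i))

/-- The incidence condition with the kernel vector `e₀` defining the orbit `O_{m+1}`:
`e₀ ∈ V_{m+1}` and `e₀ ∉ V_j` for `j < m + 1` (with `V₀ = 0`). -/
def FlagLevel (n : ℕ) (e₀ : E) (V : Fin (n + 1) → Submodule ℂ E) (m : Fin (n + 1)) : Prop :=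
  e₀ ∈ V m ∧ ∀ j : Fin (n + 1), j < m → e₀ ∉ V j

/-- A finite sequence in which no vector lies in the span of the earlier ones is linearly
independent. -/
theorem linearIndependent_of_notMem_span_Iio {K M : Type*} [DivisionRing K] [AddCommGroup M]
    [Module K M] {N : ℕ} {v : Fin N → M} (h : ∀ i, v i ∉ span K (v '' Set.Iio i)) :
    LinearIndependent K v := by
  induction N with
  | zero => exact linearIndependent_empty_type
  | succ N ih =>
    rw [linearIndependent_finSucc']
    refine ⟨ih fun i hi => h i.castSucc (span_mono ?_ hi), fun hl =>
      h (Fin.last N) (span_mono ?_ hl)⟩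
    · rintro _ ⟨j, hj, rfl⟩
      exact ⟨j.castSucc, Fin.castSucc_lt_castSucc_iff.2 hj, rfl⟩
    · rintro _ ⟨j, rfl⟩
      exact ⟨j.castSucc, Fin.castSucc_lt_last j, rfl⟩

/-- A linearly independent family of functionals takes arbitrary prescribed values at some
vector. -/
theorem LinearIndependent.exists_apply_eq {K M ι : Type*} [Field K] [AddCommGroup M]
    [Module K M] [Fintype ι] {f : ι → Dual K M} (hf : LinearIndependent K f) (c : ι → K) :
    ∃ x, ∀ i, f i x = c i := by
  classical
  have hr : LinearMap.range (LinearMap.pi f) = ⊤ := by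
    by_contra hne
    obtain ⟨φ, hφ, hle⟩ := exists_le_ker_of_lt_top _ (lt_top_iff_ne_top.2 hne)
    have hsum : ∑ i, φ (Pi.single i 1) • f i = 0 := by
      ext x
      have hx : φ (LinearMap.pi f x) = 0 := hle ⟨x, rfl⟩
      rw [← LinearMap.sum_single_apply (fun _ => K) (LinearMap.pi f x), map_sum] at hx
      rw [LinearMap.sum_apply, LinearMap.zero_apply, ← hx]
      refine Finset.sum_congr rfl fun i _ => ?_
      have : (Pi.single i (f i x) : ι → K) = f i x • Pi.single i 1 := by
        rw [← Pi.single_smul, smul_eq_mul, mul_one]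
      simp [this, mul_comm]
    have h0 := Fintype.linearIndependent_iff.1 hf _ hsum
    refine hφ (LinearMap.pi_ext' fun i => LinearMap.ext_ring ?_)
    simpa using h0 i
  obtain ⟨x, hx⟩ := LinearMap.range_eq_top.1 hr c
  exact ⟨x, fun i => congrFun hx i⟩

/-- A maximal isotropic subspace contains the kernel vector. -/
theorem IsIsotropic.mem_of_finrank_eq [FiniteDimensional ℂ E] {n : ℕ}
    (hdim : finrank ℂ E = 2 * n + 1) {ω : LinearMap.BilinForm ℂ E} (halt : ω.IsAlt) {e₀ : E}
    (hker : LinearMap.ker ω = span ℂ {e₀}) {V : Submodule ℂ E} (hV : IsIsotropic ω V)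
    (hfin : finrank ℂ V = n + 1) : e₀ ∈ V := by
  have h := LinearMap.BilinForm.finrank_add_finrank_orthogonal halt.isRefl V
  rw [LinearMap.BilinForm.orthogonal_top_eq_ker halt.isRefl, hker] at h
  have hle : V ≤ ω.orthogonal V := fun x hx y hy => hV y hy x hx
  have hmono := finrank_mono hle
  have hpos : V ⊓ span ℂ {e₀} ≠ ⊥ := by
    intro hbot
    rw [hbot, finrank_bot] at h
    omega
  obtain ⟨x, ⟨hxV, hx⟩, hx0⟩ := exists_mem_ne_zero_of_ne_bot hpos
  obtain ⟨c, rfl⟩ := mem_span_singleton.1 hx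
  exact (V.smul_mem_iff (left_ne_zero_of_smul hx0)).1 hxV

/-- A nonzero vector extends to linearly independent families of pairwise orthogonal vectors, of
every size up to `n + 1`. -/
theorem exists_linearIndependent_isotropic [FiniteDimensional ℂ E] {n : ℕ}
    (hdim : finrank ℂ E = 2 * n + 1) {ω : LinearMap.BilinForm ℂ E} (halt : ω.IsAlt) {e₀ : E}
    (he₀ : e₀ ≠ 0) (k : ℕ) (hk : k ≤ n) :
    ∃ v : Fin (k + 1) → E, v 0 = e₀ ∧ LinearIndependent ℂ v ∧ ∀ i j, ω (v i) (v j) = 0 := by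
  induction k with
  | zero =>
    exact ⟨fun _ => e₀, rfl, (linearIndependent_unique_iff (ι := Fin 1)).2 he₀, fun _ _ => halt e₀⟩
  | succ k ih =>
    obtain ⟨v, hv0, hli, hiso⟩ := ih (by omega)
    have hfin := finrank_span_eq_card hli
    rw [Fintype.card_fin] at hfin
    have h := LinearMap.BilinForm.finrank_add_finrank_orthogonal halt.isRefl
      (span ℂ (Set.range v))
    have hnle : ¬ ω.orthogonal (span ℂ (Set.range v)) ≤ span ℂ (Set.range v) := by
      intro hle
      have := finrank_mono hle
      omega
    obtain ⟨x, hx, hxv⟩ := SetLike.not_le_iff_exists.1 hnle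
    have hvx : ∀ i, ω (v i) x = 0 := fun i => hx _ (subset_span ⟨i, rfl⟩)
    refine ⟨Fin.snoc v x, ?_, linearIndependent_finSnoc.2 ⟨hli, hxv⟩, fun i j => ?_⟩
    · rw [← Fin.castSucc_zero, Fin.snoc_castSucc, hv0]
    · induction i using Fin.lastCases with
      | last =>
        induction j using Fin.lastCases with
        | last => simpa using halt x
        | cast j => simpa using halt.isRefl _ _ (hvx j)
      | cast i =>
        induction j using Fin.lastCases with
        | last => simpa using hvx i
        | cast j => simpa using hiso i j

/-- The dimension of the span of an initial segment of a linearly independent family. -/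
theorem finrank_span_image_Iic {n : ℕ} {v : Fin (n + 1) → E} (hli : LinearIndependent ℂ v)
    (i : Fin (n + 1)) : finrank ℂ (span ℂ (v '' Set.Iic i)) = (i : ℕ) + 1 := by
  have h := finrank_span_eq_card (hli.comp (Subtype.val : Set.Iic i → _) Subtype.val_injective)
  rw [Set.range_comp, Subtype.range_coe] at h
  rw [h, ← Nat.card_eq_fintype_card, Nat.card_eq_card_toFinset, Set.toFinset_Iic, Fin.card_Iic]

/-- The flag spanned by a linearly independent family of pairwise orthogonal vectors. -/
theorem isIsoFlag_span {n : ℕ} {ω : LinearMap.BilinForm ℂ E} {v : Fin (n + 1) → E}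
    (hli : LinearIndependent ℂ v) (hiso : ∀ i j, ω (v i) (v j) = 0) :
    IsIsoFlag n ω fun i => span ℂ (v '' Set.Iic i) := by
  refine ⟨fun i j hij => span_mono (Set.image_mono (Set.Iic_subset_Iic.2 hij)),
    finrank_span_image_Iic hli, fun i x hx y hy => ?_⟩
  induction hx, hy using span_induction₂ with
  | mem_mem x y hx hy =>
    obtain ⟨a, -, rfl⟩ := hx
    obtain ⟨b, -, rfl⟩ := hy
    exact hiso a b
  | zero_left => simp
  | zero_right => simp
  | add_left _ _ _ _ _ _ h₁ h₂ => simp [h₁, h₂]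
  | add_right _ _ _ _ _ _ h₁ h₂ => simp [h₁, h₂]
  | smul_left _ _ _ _ _ h => simp [h]
  | smul_right _ _ _ _ _ h => simp [h]

/-- A flag of level `m` is spanned by a linearly independent family whose `m`-th member is the
kernel vector. -/
theorem IsIsoFlag.exists_adapted [FiniteDimensional ℂ E] {n : ℕ} {ω : LinearMap.BilinForm ℂ E}
    {e₀ : E} (he₀ : e₀ ≠ 0) {V : Fin (n + 1) → Submodule ℂ E} (hV : IsIsoFlag n ω V)
    {m : Fin (n + 1)} (hm : FlagLevel n e₀ V m) :
    ∃ v : Fin (n + 1) → E, v m = e₀ ∧ LinearIndependent ℂ v ∧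
      ∀ i, V i = span ℂ (v '' Set.Iic i) := by
  obtain ⟨hmono, hfin, -⟩ := hV
  have hprev : ∀ i : Fin (n + 1), ∃ U : Submodule ℂ E, finrank ℂ U = (i : ℕ) ∧
      (∀ j < i, V j ≤ U) ∧ (i = m → e₀ ∉ U) := by
    intro i
    induction i using Fin.cases with
    | zero =>
      exact ⟨⊥, by simp, fun j hj => absurd hj (Fin.not_lt_zero j), fun _ => by simpa using he₀⟩
    | succ k =>
      refine ⟨V k.castSucc, by simp [hfin], fun j hj => hmono _ _ (Fin.le_castSucc_iff.2 hj), ?_⟩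
      rintro rfl
      exact hm.2 _ Fin.castSucc_lt_succ
  choose U hUfin hUle hUe using hprev
  have hex : ∀ i, ∃ x ∈ V i, x ∉ U i ∧ (i = m → x = e₀) := by
    intro i
    by_cases him : i = m
    · subst him
      exact ⟨e₀, hm.1, hUe i rfl, fun _ => rfl⟩
    · have hnle : ¬ V i ≤ U i := fun hle => by
        have := finrank_mono hle
        rw [hfin, hUfin] at this
        omega
      obtain ⟨x, hx, hxU⟩ := SetLike.not_le_iff_exists.1 hnle
      exact ⟨x, hx, hxU, fun h => absurd h him⟩
  choose v hvV hvU hvm using hex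
  have hli : LinearIndependent ℂ v := linearIndependent_of_notMem_span_Iio fun i hi => by
    refine hvU i (span_le.2 ?_ hi)
    rintro _ ⟨j, hj, rfl⟩
    exact hUle i j hj (hvV j)
  refine ⟨v, hvm m rfl, hli, fun i => (eq_of_le_of_finrank_eq (span_le.2 ?_) ?_).symm⟩
  · rintro _ ⟨j, hj, rfl⟩
    exact hmono j i hj (hvV j)
  · rw [finrank_span_image_Iic hli, hfin]

/-- The Gram matrix of a symplectic basis `(v, w)` in which `v m` spans the kernel. -/
def oddGram {n : ℕ} (m : Fin (n + 1)) :
    Fin (n + 1) ⊕ {j : Fin (n + 1) // j ≠ m} → Fin (n + 1) ⊕ {j : Fin (n + 1) // j ≠ m} → ℂ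
  | .inl _, .inl _ => 0
  | .inl i, .inr j => if i = j then 1 else 0
  | .inr j, .inl i => -if i = j then 1 else 0
  | .inr _, .inr _ => 0

/-- A basis of a maximal isotropic subspace containing the kernel vector has a family of
pairwise orthogonal dual vectors. -/
theorem exists_dual_family {n : ℕ} {ω : LinearMap.BilinForm ℂ E} (halt : ω.IsAlt)
    {v : Fin (n + 1) → E} (hli : LinearIndependent ℂ v) (hiso : ∀ i j, ω (v i) (v j) = 0)
    {m : Fin (n + 1)} (hker : LinearMap.ker ω = span ℂ {v m}) :
    ∃ w : {j : Fin (n + 1) // j ≠ m} → E,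
      (∀ i j, ω (v i) (w j) = if i = j then 1 else 0) ∧ ∀ j k, ω (w j) (w k) = 0 := by
  have hanti : ∀ x y, ω x y = -ω y x := fun x y => (halt.neg_eq y x).symm
  have hdisj : Disjoint (span ℂ (Set.range fun j : {j : Fin (n + 1) // j ≠ m} => v j))
      (LinearMap.ker ω) := by
    have h := hli.disjoint_span_image (s := {j | j ≠ m}) (t := {m}) (by simp)
    rwa [Set.image_singleton, ← hker, Set.image_eq_range] at h
  have hω : LinearIndependent ℂ (ω ∘ fun j : {j : Fin (n + 1) // j ≠ m} => v j) :=
    (hli.comp _ Subtype.val_injective).map hdisj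
  choose u hu using fun k : {j : Fin (n + 1) // j ≠ m} =>
    LinearIndependent.exists_apply_eq hω (Pi.single k 1)
  have hvm : ∀ x, ω (v m) x = 0 := fun x => by
    have : v m ∈ LinearMap.ker ω := hker ▸ mem_span_singleton_self _
    rw [LinearMap.mem_ker.1 this, LinearMap.zero_apply]
  have hvu : ∀ i j, ω (v i) (u j) = if i = j then 1 else 0 := fun i j => by
    by_cases hi : i = m
    · subst hi
      rw [hvm, if_neg j.2.symm]
    · have := hu j ⟨i, hi⟩
      simpa [Pi.single_apply, Subtype.ext_iff] using this
  have hvu' : ∀ (i j : {j : Fin (n + 1) // j ≠ m}), ω (v i) (u j) = if i = j then 1 else 0 := by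
    simpa [Subtype.ext_iff] using fun (i j : {j : Fin (n + 1) // j ≠ m}) => hvu i j
  refine ⟨fun j => u j + ∑ i : {j : Fin (n + 1) // j ≠ m}, (ω (u i) (u j) / 2) • v i,
    fun i j => ?_, fun j k => ?_⟩
  · simp [map_add, map_sum, hvu, hiso]
  · simp only [map_add, map_sum, map_smul, LinearMap.add_apply, LinearMap.sum_apply,
      LinearMap.smul_apply, hiso, hvu', hanti (u j) (v _), smul_eq_mul]
    simp
    rw [hanti (u k) (u j)]
    ring

/-- Every flag of level `m` is spanned by the first half of a basis with Gram matrix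
`oddGram m`. -/
theorem IsIsoFlag.exists_basis [FiniteDimensional ℂ E] {n : ℕ} (hdim : finrank ℂ E = 2 * n + 1)
    {ω : LinearMap.BilinForm ℂ E} (halt : ω.IsAlt) {e₀ : E} (he₀ : e₀ ≠ 0)
    (hker : LinearMap.ker ω = span ℂ {e₀}) {V : Fin (n + 1) → Submodule ℂ E}
    (hV : IsIsoFlag n ω V) {m : Fin (n + 1)} (hm : FlagLevel n e₀ V m) :
    ∃ b : Basis (Fin (n + 1) ⊕ {j : Fin (n + 1) // j ≠ m}) ℂ E,
      (∀ s t, ω (b s) (b t) = oddGram m s t) ∧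
      ∀ i, V i = span ℂ ((fun j => b (.inl j)) '' Set.Iic i) := by
  obtain ⟨v, rfl, hli, hspan⟩ := hV.exists_adapted he₀ hm
  have hmem : ∀ i, v i ∈ V (Fin.last n) := fun i => by
    rw [hspan]
    exact subset_span ⟨i, Fin.le_last i, rfl⟩
  have hiso : ∀ i j, ω (v i) (v j) = 0 := fun i j => hV.2.2 _ _ (hmem i) _ (hmem j)
  obtain ⟨w, hvw, hww⟩ := exists_dual_family halt hli hiso hker
  have hind : LinearIndependent ℂ (Sum.elim v w) := by
    rw [Fintype.linearIndependent_iff]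
    intro c hc
    simp only [Fintype.sum_sum_type, Sum.elim_inl, Sum.elim_inr] at hc
    have hw : ∀ j, c (.inr j) = 0 := fun j => by
      have := congrArg (ω (v j)) hc
      simpa [map_sum, hiso, hvw, ← Subtype.ext_iff] using this
    simp only [hw, zero_smul, Finset.sum_const_zero, add_zero] at hc
    rintro (i | j)
    · exact Fintype.linearIndependent_iff.1 hli _ hc i
    · exact hw j
  have hcard : Fintype.card (Fin (n + 1) ⊕ {j : Fin (n + 1) // j ≠ m}) = finrank ℂ E := by
    rw [hdim, Fintype.card_sum, Fintype.card_subtype_compl]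
    simp
    omega
  refine ⟨basisOfLinearIndependentOfCardEqFinrank hind hcard, ?_, ?_⟩
  · rw [coe_basisOfLinearIndependentOfCardEqFinrank]
    rintro (i | i) (j | j)
    · exact hiso i j
    · exact hvw i j
    · exact (halt.neg_eq _ _).symm.trans (congrArg Neg.neg (hvw j i))
    · exact hww i j
  · simpa [coe_basisOfLinearIndependentOfCardEqFinrank] using hspan

/-- The image of a subspace under a form-preserving automorphism contains the kernel vector if
and only if the subspace does. -/
theorem mem_map_iff_of_mem_sympGroup {ω : LinearMap.BilinForm ℂ E} {e₀ : E} (he₀ : e₀ ≠ 0)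
    (hker : LinearMap.ker ω = span ℂ {e₀}) {g : E ≃ₗ[ℂ] E} (hg : g ∈ sympGroup ω)
    (V : Submodule ℂ E) : e₀ ∈ V.map (g : E →ₗ[ℂ] E) ↔ e₀ ∈ V := by
  have hg' : ∀ x y, ω (g x) (g y) = ω x y := hg
  have hmem : g e₀ ∈ span ℂ {e₀} := by
    rw [← hker, LinearMap.mem_ker]
    ext y
    have he : e₀ ∈ LinearMap.ker ω := hker ▸ mem_span_singleton_self _
    rw [← g.apply_symm_apply y, hg', LinearMap.mem_ker.1 he]
    rfl
  obtain ⟨c, hc⟩ := mem_span_singleton.1 hmem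
  have hc0 : c ≠ 0 := by
    rintro rfl
    rw [zero_smul] at hc
    exact he₀ (g.map_eq_zero_iff.1 hc.symm)
  rw [← smul_mem_iff _ hc0, hc]
  exact ⟨fun ⟨x, hx, hgx⟩ => g.injective hgx ▸ hx, fun h => ⟨e₀, h, rfl⟩⟩

/-- Every complete isotropic flag has a unique level. -/
theorem IsIsoFlag.existsUnique_flagLevel [FiniteDimensional ℂ E] {n : ℕ}
    (hdim : finrank ℂ E = 2 * n + 1) {ω : LinearMap.BilinForm ℂ E} (halt : ω.IsAlt) {e₀ : E}
    (hker : LinearMap.ker ω = span ℂ {e₀}) {V : Fin (n + 1) → Submodule ℂ E}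
    (hV : IsIsoFlag n ω V) : ∃! m : Fin (n + 1), FlagLevel n e₀ V m := by
  have hlast : e₀ ∈ V (Fin.last n) :=
    (hV.2.2 _).mem_of_finrank_eq hdim halt hker (by simp [hV.2.1])
  obtain ⟨m, hm, hmin⟩ := WellFounded.has_min wellFounded_lt {i | e₀ ∈ V i} ⟨_, hlast⟩
  refine ⟨m, ⟨hm, fun j hj hmem => hmin j hmem hj⟩, fun k hk => ?_⟩
  rcases lt_trichotomy k m with h | h | h
  · exact absurd h (hmin k hk.1)
  · exact h
  · exact absurd hm (hk.2 m h)

/-- The odd symplectic group acts on the set of complete isotropic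
flags of `E` with exactly `n+1` orbits `O₁, …, O_{n+1}`, where
`O_i = {V_• : e₀ ∈ V_i, e₀ ∉ V_{i−1}}`: these sets are nonempty, they partition the set
of complete isotropic flags, and the group acts transitively on each of them. -/
theorem odd_symplectic_flag_orbits
    (n : ℕ) (hn : 1 ≤ n) [FiniteDimensional ℂ E] (hdim : finrank ℂ E = 2 * n + 1)
    (ω : LinearMap.BilinForm ℂ E) (halt : ω.IsAlt)
    (e₀ : E) (he₀ : e₀ ≠ 0) (hker : LinearMap.ker ω = Submodule.span ℂ {e₀}) :
    -- every O_i is nonempty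
    (∀ m : Fin (n + 1), ∃ V : Fin (n + 1) → Submodule ℂ E,
      IsIsoFlag n ω V ∧ FlagLevel n e₀ V m) ∧
    -- the O_i partition the set of complete isotropic flags
    (∀ V : Fin (n + 1) → Submodule ℂ E, IsIsoFlag n ω V →
      ∃! m : Fin (n + 1), FlagLevel n e₀ V m) ∧
    -- two flags lie in the same orbit of the odd symplectic group iff they lie
    -- in the same O_i
    (∀ V W : Fin (n + 1) → Submodule ℂ E, IsIsoFlag n ω V → IsIsoFlag n ω W →
      ((∃ g ∈ sympGroup ω, ∀ i : Fin (n + 1),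
          Submodule.map ((g : E ≃ₗ[ℂ] E) : E →ₗ[ℂ] E) (V i) = W i) ↔
        (∀ m : Fin (n + 1), FlagLevel n e₀ V m ↔ FlagLevel n e₀ W m))) := by
  refine ⟨fun m => ?_, fun V hV => hV.existsUnique_flagLevel hdim halt hker,
    fun V W hV hW => ⟨?_, fun h => ?_⟩⟩
  · obtain ⟨v, hv0, hli, hiso⟩ :=
      exists_linearIndependent_isotropic hdim halt he₀ n le_rfl
    let σ : Equiv.Perm (Fin (n + 1)) := Equiv.swap 0 m
    have hσ : (v ∘ σ) m = e₀ := by simp [σ, hv0]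
    have hli' : LinearIndependent ℂ (v ∘ σ) := hli.comp σ σ.injective
    refine ⟨_, isIsoFlag_span hli' fun i j => hiso (σ i) (σ j), ?_, fun j hj => ?_⟩
    · exact subset_span ⟨m, Set.self_mem_Iic, hσ⟩
    · rw [← hσ]
      exact hli'.notMem_span_image (not_le.2 hj)
  · rintro ⟨g, hg, hgV⟩ m
    simp only [FlagLevel, ← hgV, mem_map_iff_of_mem_sympGroup he₀ hker hg]
  · obtain ⟨m, hm, -⟩ := hV.existsUnique_flagLevel hdim halt hker
    obtain ⟨b, hb, hbV⟩ := hV.exists_basis hdim halt he₀ hker hm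
    obtain ⟨c, hc, hcW⟩ := hW.exists_basis hdim halt he₀ hker ((h m).1 hm)
    let g : E ≃ₗ[ℂ] E := b.equiv c (Equiv.refl _)
    have hgb : ∀ s, g (b s) = c s := fun s => b.equiv_apply s c (Equiv.refl _)
    refine ⟨g, ?_, fun i => ?_⟩
    · have hform : ω.compl₁₂ (g : E →ₗ[ℂ] E) (g : E →ₗ[ℂ] E) = ω :=
        LinearMap.BilinForm.ext_basis b fun s t => by simp [hgb, hb, hc]
      exact fun x y => LinearMap.congr_fun₂ hform x y
    · rw [hbV, hcW, map_span, Set.image_image]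
      simp [hgb]

end
end

section
/- Fix 1 ≤ k ≤ n+1 and a k-element subset I of {0, 1, …, 2n}. There exists a k-dimensional isotropic subspace V of E whose incidence type with the flag E_• equals I if and only if I is admissible, i.e. for every 1 ≤ i ≤ n not both i and 2n+1−i belong to I. -/
open Module Submodule

noncomputable section

variable {E : Type*} [AddCommGroup E] [Module ℂ E]

/-- The reference flag: `Efl j = span(e₀, …, e_{j−1})` (so `Efl 0 = 0`). -/
def Efl (n : ℕ) (e : Basis (Fin (2 * n + 1)) ℂ E) (j : ℕ) : Submodule ℂ E :=
  Submodule.span ℂ (e '' {i : Fin (2 * n + 1) | (i : ℕ) < j})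

lemma mem_Efl_iff (n : ℕ) (e : Basis (Fin (2 * n + 1)) ℂ E) (j : ℕ) (x : E) :
    x ∈ Efl n e j ↔ ∀ i : Fin (2 * n + 1), j ≤ (i : ℕ) → e.repr x i = 0 := by
  rw [Efl, Basis.mem_span_image]
  refine ⟨fun h i hi => ?_, fun h i hi => ?_⟩
  · by_contra hx
    have : (i : ℕ) < j := h (Finsupp.mem_support_iff.2 hx)
    omega
  · by_contra hx
    exact Finsupp.mem_support_iff.1 hi (h i (not_lt.1 hx))

/-- At a jump of `j ↦ dim (V ∩ E_j)` there is a vector of `V ∩ E_{j+1}` with nonzero leading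
coordinate. -/
lemma exists_repr_ne_zero_of_finrank_eq_add_one (n : ℕ) (e : Basis (Fin (2 * n + 1)) ℂ E)
    (V : Submodule ℂ E) (j : Fin (2 * n + 1))
    (h : finrank ℂ ↥(V ⊓ Efl n e ((j : ℕ) + 1)) = finrank ℂ ↥(V ⊓ Efl n e (j : ℕ)) + 1) :
    ∃ v ∈ V, v ∈ Efl n e ((j : ℕ) + 1) ∧ e.repr v j ≠ 0 := by
  have : FiniteDimensional ℂ E := e.finiteDimensional_of_finite
  by_contra! hv
  have hle : V ⊓ Efl n e ((j : ℕ) + 1) ≤ V ⊓ Efl n e (j : ℕ) := by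
    rintro x ⟨hxV, hx⟩
    refine ⟨hxV, (mem_Efl_iff n e _ x).2 fun i hi => ?_⟩
    rcases hi.eq_or_lt with hij | hij
    · rw [← Fin.ext hij]
      exact hv x hxV hx
    · exact (mem_Efl_iff n e _ x).1 hx i hij
  have := Submodule.finrank_mono hle
  omega

/-- On `E_{j+1} × E_{j'+1}` with `j + j' = 2n+1`, the form only sees the leading coordinates. -/
lemma apply_eq_of_mem_Efl (n : ℕ) (ω : LinearMap.BilinForm ℂ E)
    (e : Basis (Fin (2 * n + 1)) ℂ E)
    (h0 : ∀ i j : Fin (2 * n + 1), (i : ℕ) + (j : ℕ) ≠ 2 * n + 1 → ω (e i) (e j) = 0)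
    {j j' : Fin (2 * n + 1)} (hjj' : (j : ℕ) + (j' : ℕ) = 2 * n + 1) {v w : E}
    (hv : v ∈ Efl n e ((j : ℕ) + 1)) (hw : w ∈ Efl n e ((j' : ℕ) + 1)) :
    ω v w = e.repr v j * e.repr w j' * ω (e j) (e j') := by
  rw [mem_Efl_iff] at hv hw
  have hz : ∀ a b : Fin (2 * n + 1), ¬(a = j ∧ b = j') →
      e.repr v a * (e.repr w b * ω (e a) (e b)) = 0 := by
    intro a b hab
    by_cases ha : (j : ℕ) + 1 ≤ a
    · simp [hv a ha]
    by_cases hb : (j' : ℕ) + 1 ≤ b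
    · simp [hw b hb]
    have hne : (a : ℕ) + (b : ℕ) ≠ 2 * n + 1 := fun hs =>
      hab ⟨Fin.ext (by omega), Fin.ext (by omega)⟩
    simp [h0 a b hne]
  rw [← LinearMap.sum_repr_mul_repr_mul e e, Finsupp.sum_fintype _ _ (by simp),
    Finset.sum_eq_single j, Finsupp.sum_fintype _ _ (by simp), Finset.sum_eq_single j']
  · simp [mul_assoc]
  · intro b _ hb
    simpa using hz j b fun h => hb h.2
  · simp
  · intro a _ ha
    rw [Finsupp.sum_fintype _ _ (by simp)]
    refine Finset.sum_eq_zero fun b _ => ?_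
    simpa using hz a b fun h => ha h.1
  · simp

lemma finrank_span_image_basis {ι : Type*} (e : Basis ι ℂ E) (s : Finset ι) :
    finrank ℂ (span ℂ (e '' (s : Set ι))) = s.card := by
  classical
  rw [← Finset.coe_image, finrank_span_finset_eq_card,
    Finset.card_image_of_injective _ e.injective]
  rw [Finset.coe_image]
  exact e.linearIndependent.linearIndepOn_id.mono (Set.image_subset_range _ _)

lemma finrank_span_image_inf_Efl (n : ℕ) (e : Basis (Fin (2 * n + 1)) ℂ E)
    (I : Finset (Fin (2 * n + 1))) (j : ℕ) :
    finrank ℂ ↥(span ℂ (e '' (I : Set (Fin (2 * n + 1)))) ⊓ Efl n e j) =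
      (I.filter fun i : Fin (2 * n + 1) => (i : ℕ) < j).card := by
  have hinf : span ℂ (e '' (I : Set (Fin (2 * n + 1)))) ⊓ Efl n e j =
      span ℂ (e '' ((I.filter fun i : Fin (2 * n + 1) => (i : ℕ) < j :
        Finset (Fin (2 * n + 1))) : Set (Fin (2 * n + 1)))) := by
    ext x
    simp only [Efl, Submodule.mem_inf, Basis.mem_span_image, ← Set.subset_inter_iff,
      Finset.coe_filter]
    rfl
  rw [hinf, finrank_span_image_basis]

lemma isIsotropic_span {ω : LinearMap.BilinForm ℂ E} {s : Set E}
    (h : ∀ x ∈ s, ∀ y ∈ s, ω x y = 0) : IsIsotropic ω (span ℂ s) := by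
  intro x hx y hy
  induction hx, hy using Submodule.span_induction₂ with
  | mem_mem x y hx hy => exact h x hx y hy
  | zero_left y hy => simp
  | zero_right x hx => simp
  | add_left x y z _ _ _ hxz hyz => simp [hxz, hyz]
  | add_right x y z _ _ _ hxy hxz => simp [hxy, hxz]
  | smul_left r x y _ _ h => simp [h]
  | smul_right r x y _ _ h => simp [h]

/-- Fix `1 ≤ k ≤ n+1` and a `k`-element subset `I` of `{0, …, 2n}`.
There is a `k`-dimensional isotropic subspace of `E` whose incidence type with the
reference flag `E_•` (the set of positions of the jumps of `j ↦ dim(V ∩ E_j)`) equals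
`I` if and only if `I` is admissible, i.e. for every `1 ≤ i ≤ n` not both `i` and
`2n+1−i` belong to `I`. -/
theorem schubert_cells_admissible_indices
    (n k : ℕ) (hn : 1 ≤ n) (hk1 : 1 ≤ k) (hkn : k ≤ n + 1)
    [FiniteDimensional ℂ E] (hdim : finrank ℂ E = 2 * n + 1)
    (ω : LinearMap.BilinForm ℂ E) (halt : ω.IsAlt)
    (e : Basis (Fin (2 * n + 1)) ℂ E)
    (he : ∀ i j : Fin (2 * n + 1), (i : ℕ) < (j : ℕ) →
      ω (e i) (e j) = if (i : ℕ) + (j : ℕ) = 2 * n + 1 then 1 else 0)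
    (I : Finset (Fin (2 * n + 1))) (hI : I.card = k) :
    (∃ V : Submodule ℂ E, finrank ℂ V = k ∧ IsIsotropic ω V ∧
      (∀ j : Fin (2 * n + 1), j ∈ I ↔
        finrank ℂ ↥(V ⊓ Efl n e ((j : ℕ) + 1)) = finrank ℂ ↥(V ⊓ Efl n e (j : ℕ)) + 1)) ↔
    (∀ j j' : Fin (2 * n + 1), 1 ≤ (j : ℕ) → (j : ℕ) ≤ n → (j' : ℕ) = 2 * n + 1 - (j : ℕ) →
      ¬(j ∈ I ∧ j' ∈ I)) := by
  have h0 : ∀ i j : Fin (2 * n + 1), (i : ℕ) + (j : ℕ) ≠ 2 * n + 1 → ω (e i) (e j) = 0 := by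
    intro i j hij
    rcases lt_trichotomy (i : ℕ) (j : ℕ) with h | h | h
    · rw [he i j h, if_neg hij]
    · rw [Fin.ext h, halt.self_eq_zero]
    · rw [← neg_eq_zero, halt.neg_eq, he j i h, if_neg (by omega)]
  constructor
  · rintro ⟨V, -, hV, hVI⟩ j j' - hjn hj' ⟨hj, hjI'⟩
    obtain ⟨v, hvV, hv, hvj⟩ :=
      exists_repr_ne_zero_of_finrank_eq_add_one n e V j ((hVI j).1 hj)
    obtain ⟨w, hwV, hw, hwj⟩ :=
      exists_repr_ne_zero_of_finrank_eq_add_one n e V j' ((hVI j').1 hjI')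
    have hvw := hV v hvV w hwV
    rw [apply_eq_of_mem_Efl n ω e h0 (by omega) hv hw, he j j' (by omega), if_pos (by omega),
      mul_one] at hvw
    exact mul_ne_zero hvj hwj hvw
  · intro hadm
    refine ⟨span ℂ (e '' (I : Set (Fin (2 * n + 1)))), ?_, isIsotropic_span ?_, fun j => ?_⟩
    · rw [finrank_span_image_basis, hI]
    · rintro _ ⟨i, hi, rfl⟩ _ ⟨j, hj, rfl⟩
      refine h0 i j fun hij => ?_
      rcases lt_or_ge n (i : ℕ) with h | h
      · exact hadm j i (by omega) (by omega) (by omega) ⟨hj, hi⟩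
      · exact hadm i j (by omega) h (by omega) ⟨hi, hj⟩
    · rw [finrank_span_image_inf_Efl, finrank_span_image_inf_Efl]
      by_cases hj : j ∈ I
      · have : (I.filter fun i : Fin (2 * n + 1) => (i : ℕ) < j + 1) =
            insert j (I.filter fun i : Fin (2 * n + 1) => (i : ℕ) < j) := by
          ext i
          simp only [Finset.mem_filter, Finset.mem_insert, Fin.ext_iff]
          refine ⟨fun h => ?_, ?_⟩
          · by_cases hij : (i : ℕ) = j
            · exact Or.inl hij
            · exact Or.inr ⟨h.1, by omega⟩
          · rintro (h | h)
            · exact ⟨Fin.ext h ▸ hj, by omega⟩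
            · exact ⟨h.1, by omega⟩
        rw [this, Finset.card_insert_of_notMem (by simp)]
        simp only [hj]
      · have : (I.filter fun i : Fin (2 * n + 1) => (i : ℕ) < j + 1) =
            I.filter fun i : Fin (2 * n + 1) => (i : ℕ) < j := by
          refine Finset.filter_congr fun i hi => ?_
          have : (i : ℕ) ≠ j := fun h => hj (Fin.ext h ▸ hi)
          omega
        rw [this]
        simp [hj]

end
end

section
/- Let v_1, …, v_k ∈ E be linearly independent vectors, with k ≥ 2. Then the contraction of v_1 ∧ … ∧ v_k by ω vanishes, i.e. Σ_{1 ≤ p < q ≤ k} (−1)^{p+q} ω(v_p, v_q) · v_1 ∧ … ∧ v̂_p ∧ … ∧ v̂_q ∧ … ∧ v_k = 0 in Λ^{k−2}E (where v̂ means the factor is omitted), if and only if the subspace span{v_1, …, v_k} is isotropic. (Equivalently, a k-dimensional subspace V of E is isotropic exactly when its Plücker point lies in the kernel of the contraction map ⌟ω : Λ^k E → Λ^{k−2} E.) -/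
open Module Submodule

/-- The exterior products of a linearly independent family along all increasing sequences of
indices are linearly independent in the exterior algebra. -/
lemma ExteriorAlgebra.linearIndependent_ιMulti_comp_orderEmb {K E I : Type*} [Field K]
    [AddCommGroup E] [Module K E] [LinearOrder I] {v : I → E} (hv : LinearIndependent K v)
    (m : ℕ) :
    LinearIndependent K fun f : Fin m ↪o I => ExteriorAlgebra.ιMulti K m (v ∘ f) := by
  have h := ((exteriorPower.ιMulti_family_linearIndependent_field (n := m) hv).map'
    (Submodule.subtype _) (Submodule.ker_subtype _)).comp _
      (Set.powersetCard.ofFinEmbEquiv (n := m) (I := I)).injective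
  have hfun : (fun f : Fin m ↪o I => ExteriorAlgebra.ιMulti K m (v ∘ f)) =
      ((⋀[K]^m E).subtype ∘ exteriorPower.ιMulti_family K m v) ∘
        Set.powersetCard.ofFinEmbEquiv := by
    ext f
    simp [exteriorPower.ιMulti_family]
  exact hfun ▸ h

/-- The increasing enumeration of the indices other than `p < q`. -/
def Fin.succAbovePairEmb {m : ℕ} (p q : Fin (m + 2)) (h : p < q) : Fin m ↪o Fin (m + 2) :=
  (Fin.succAboveOrderEmb (p.castPred (Fin.ne_last_of_lt h))).trans (Fin.succAboveOrderEmb q)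

lemma Fin.range_succAbovePairEmb {m : ℕ} (p q : Fin (m + 2)) (h : p < q) :
    Set.range (Fin.succAbovePairEmb p q h) = {p, q}ᶜ := by
  have hp : q.succAbove (p.castPred (Fin.ne_last_of_lt h)) = p := by
    rw [Fin.succAbove_of_castSucc_lt] <;> simp [h]
  ext x
  rcases eq_or_ne x q with rfl | hx
  · simp [Fin.succAbovePairEmb, Fin.succAbove_ne]
  · obtain ⟨y, rfl⟩ := Fin.exists_succAbove_eq hx
    have key : q.succAbove y = p ↔ y = p.castPred (Fin.ne_last_of_lt h) := by
      rw [← Fin.succAbove_right_inj (p := q), hp]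
    simp [Fin.succAbovePairEmb, Fin.succAbove_ne, key, Fin.exists_succAbove_eq_iff]

lemma Fin.succAbovePairEmb_injective {m : ℕ} :
    Function.Injective fun x : {x : Fin (m + 2) × Fin (m + 2) // x.1 < x.2} =>
      Fin.succAbovePairEmb x.1.1 x.1.2 x.2 := by
  rintro ⟨⟨p, q⟩, h⟩ ⟨⟨p', q'⟩, h'⟩ heq
  have hset : ({p, q} : Set (Fin (m + 2))) = {p', q'} := by
    rw [← compl_inj_iff, ← Fin.range_succAbovePairEmb p q h, ← Fin.range_succAbovePairEmb p' q' h']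
    exact congrArg (fun f : Fin m ↪o Fin (m + 2) => Set.range f) heq
  rcases Set.pair_eq_pair_iff.1 hset with ⟨rfl, rfl⟩ | ⟨rfl, rfl⟩
  · rfl
  · exact absurd h (not_lt_of_gt h')

/-- A bilinear form vanishes on a span as soon as it vanishes on pairs of generators. -/
lemma LinearMap.BilinForm.eq_zero_of_mem_span {R M ι : Type*} [CommRing R] [AddCommGroup M]
    [Module R M] (B : LinearMap.BilinForm R M) {v : ι → M} (h : ∀ i j, B (v i) (v j) = 0)
    {x y : M} (hx : x ∈ Submodule.span R (Set.range v))
    (hy : y ∈ Submodule.span R (Set.range v)) : B x y = 0 := by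
  induction hx, hy using Submodule.span_induction₂ with
  | mem_mem x y hx hy =>
    obtain ⟨i, rfl⟩ := hx
    obtain ⟨j, rfl⟩ := hy
    exact h i j
  | zero_left => simp
  | zero_right => simp
  | add_left _ _ _ _ _ _ h₁ h₂ => simp [h₁, h₂]
  | add_right _ _ _ _ _ _ h₁ h₂ => simp [h₁, h₂]
  | smul_left _ _ _ _ _ h => simp [h]
  | smul_right _ _ _ _ _ h => simp [h]

/-- Let `v₁, …, v_k ∈ E` (`k = m + 2 ≥ 2`) be linearly independent.
The contraction of `v₁ ∧ … ∧ v_k` by `ω`, namely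
`Σ_{p<q} (−1)^{p+q} ω(v_p, v_q) · v₁ ∧ … ∧ v̂_p ∧ … ∧ v̂_q ∧ … ∧ v_k`,
vanishes in `Λ^{k−2}E` if and only if `span{v₁, …, v_k}` is isotropic. -/
theorem plucker_contraction_vanishes_iff_isotropic
    {E : Type*} [AddCommGroup E] [Module ℂ E] [FiniteDimensional ℂ E]
    (n : ℕ) (hn : 1 ≤ n) (hdim : finrank ℂ E = 2 * n + 1)
    (ω : LinearMap.BilinForm ℂ E) (halt : ω.IsAlt)
    (hker : finrank ℂ (LinearMap.ker ω) = 1)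
    (m : ℕ) (v : Fin (m + 2) → E) (hv : LinearIndependent ℂ v) :
    ((∑ p : Fin (m + 2), ∑ q : Fin (m + 2),
        if h : p < q then
          ((-1 : ℂ) ^ ((p : ℕ) + (q : ℕ)) * ω (v p) (v q)) •
            ExteriorAlgebra.ιMulti ℂ m
              (fun i : Fin m => v (q.succAbove ((p.castPred (Fin.ne_last_of_lt h)).succAbove i)))
        else 0) = 0) ↔
      (∀ x ∈ Submodule.span ℂ (Set.range v), ∀ y ∈ Submodule.span ℂ (Set.range v),
        ω x y = 0) := by
  constructor
  · intro hsum
    have hli := (ExteriorAlgebra.linearIndependent_ιMulti_comp_orderEmb hv m).comp _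
      Fin.succAbovePairEmb_injective
    rw [Fintype.linearIndependent_iff] at hli
    have hcoeff := hli
      (fun x => (-1 : ℂ) ^ ((x.1.1 : ℕ) + (x.1.2 : ℕ)) * ω (v x.1.1) (v x.1.2)) (by
        rw [← Fintype.sum_prod_type', Finset.sum_dite, Finset.sum_const_zero, add_zero] at hsum
        rw [← hsum]
        refine Fintype.sum_equiv (Equiv.subtypeEquivRight fun x => by simp) _ _ fun x => rfl)
    have hlt : ∀ p q, p < q → ω (v p) (v q) = 0 := fun p q h =>
      (mul_eq_zero.1 (hcoeff ⟨(p, q), h⟩)).resolve_left (pow_ne_zero _ (by simp))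
    intro x hx y hy
    refine ω.eq_zero_of_mem_span (fun p q => ?_) hx hy
    rcases lt_trichotomy p q with h | rfl | h
    · exact hlt p q h
    · exact halt _
    · rw [← LinearMap.BilinForm.IsAlt.neg_eq halt, hlt q p h, neg_zero]
  · intro h
    refine Finset.sum_eq_zero fun p _ => Finset.sum_eq_zero fun q _ => ?_
    have hpq : ω (v p) (v q) = 0 :=
      h _ (Submodule.subset_span ⟨p, rfl⟩) _ (Submodule.subset_span ⟨q, rfl⟩)
    simp [hpq]
end
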